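/- arXiv:1408.0447 — 2 statements merged into one kernel-verified Lean document; each statement's English description precedes it below -/
import Mathlib

section
/- Let n = 2m+1 with m ≥ 2 an integer, and let 0 < κ. Suppose f ∈ C²((0,∞)) and g ∈ C¹((0,∞)) satisfy, for some R > 0, either (i) f(r) ≥ C₁/(1+r)^κ, g(r) > 0 and −m(m−1)f(r)/r + g(r) > 0 for all r ≥ R, for some C₁ > 0, or (ii) f(r) > 0, g(r) > 0 and −m(m−1)f(r)/r + g(r) ≥ C₂/(1+r)^{1+κ} for all r ≥ R, for some C₂ > 0. Let η ∈ (0,1] be a constant such that P_{m−1}(z) ≥ 1/2 and 0 < P'_{m−1}(z) ≤ m(m−1)/2 for all z with 1/(1+η) ≤ z ≤ 1, and let δ ≥ 2/η. If u⁰ ∈ C²((0,∞) × [0,∞)) is a classical solution of the free radial wave equation u⁰_tt − u⁰_rr − ((n−1)/r)·u⁰_r = 0 with u⁰(r,0) = f(r) and u⁰_t(r,0) = g(r), then for all (r,t) ∈ Σ₁: u⁰(r,t) ≥ (1/(2r^m))·[f(r+t)(r+t)^m + f(r−t)(r−t)^m] + (1/(4r^m))·∫_{r−t}^{r+t} λ^m·(−m(m−1)·f(λ)/λ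 + g(λ)) dλ. -/
open MeasureTheory Set

/-- The Legendre polynomial of degree `k`, via Rodrigues' formula. -/
noncomputable def legendreP (k : ℕ) (z : ℝ) : ℝ :=
  (1 / (2 ^ k * (Nat.factorial k : ℝ))) * iteratedDeriv k (fun x : ℝ => (x ^ 2 - 1) ^ k) z

open Polynomial in
/-- The Legendre polynomial of degree `k` as an element of `ℝ[X]`. -/
noncomputable def legendrePoly (k : ℕ) : ℝ[X] :=
  C (1 / (2 ^ k * (Nat.factorial k : ℝ))) * derivative^[k] ((X ^ 2 - 1) ^ k)

open Polynomial in
lemma iteratedDeriv_polynomial_eval (p : ℝ[X]) (k : ℕ) :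
    iteratedDeriv k (fun x : ℝ => p.eval x) = fun x => (derivative^[k] p).eval x := by
  induction k with
  | zero => simp
  | succ k ih =>
    rw [iteratedDeriv_succ, ih]
    funext x
    rw [Polynomial.deriv, Function.iterate_succ_apply']

lemma legendreP_eq_eval (k : ℕ) : legendreP k = fun z => (legendrePoly k).eval z := by
  funext z
  have h := congrFun (iteratedDeriv_polynomial_eval ((Polynomial.X ^ 2 - 1) ^ k) k) z
  simp only [Polynomial.eval_pow, Polynomial.eval_sub, Polynomial.eval_X,
    Polynomial.eval_one] at h
  rw [legendreP, h, legendrePoly, Polynomial.eval_mul, Polynomial.eval_C]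

open Polynomial in
lemma iterate_derivative_X_sq_sub_one_pow_ode (k j : ℕ) :
    (X ^ 2 - 1) * derivative^[j + 2] ((X ^ 2 - 1 : ℝ[X]) ^ k)
      + 2 * ((j : ℝ[X]) + 1 - (k : ℝ[X])) * X * derivative^[j + 1] ((X ^ 2 - 1 : ℝ[X]) ^ k)
      + ((j : ℝ[X]) + 1) * ((j : ℝ[X]) - 2 * (k : ℝ[X])) * derivative^[j] ((X ^ 2 - 1 : ℝ[X]) ^ k) = 0 := by
  induction j with
  | zero =>
    have h : (X ^ 2 - 1) * derivative ((X ^ 2 - 1 : ℝ[X]) ^ k)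
        = 2 * (k : ℝ[X]) * X * (X ^ 2 - 1) ^ k := by
      rcases k with _ | k
      · simp
      · simp [derivative_pow, map_ofNat C]
        ring
    have h' := congrArg derivative h
    simp [derivative_mul] at h'
    simp
    linear_combination h'
  | succ j ih =>
    have h' := congrArg derivative ih
    simp only [derivative_add, derivative_mul, derivative_sub, ← Function.iterate_succ_apply',
      derivative_X_sq, derivative_one, derivative_X, derivative_natCast, derivative_ofNat,
      derivative_zero] at h'
    push_cast
    simp only [map_ofNat] at h'
    linear_combination h'

open Polynomial in
lemma legendrePoly_ode (k : ℕ) (z : ℝ) :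
    (1 - z ^ 2) * (derivative (derivative (legendrePoly k))).eval z
      - 2 * z * (derivative (legendrePoly k)).eval z
      + k * (k + 1) * (legendrePoly k).eval z = 0 := by
  have h := congrArg (eval z) (iterate_derivative_X_sq_sub_one_pow_ode k k)
  simp only [legendrePoly, derivative_C_mul, ← Function.iterate_succ_apply', eval_mul, eval_C]
  simp at h
  simp only [Nat.succ_eq_add_one, Function.iterate_succ_apply] at h ⊢
  linear_combination (-(1 / (2 ^ k * (Nat.factorial k : ℝ)))) * h

open Polynomial in
lemma legendrePoly_eval_one (k : ℕ) : (legendrePoly k).eval 1 = 1 := by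
  have h : (derivative^[k] ((X ^ 2 - 1 : ℝ[X]) ^ k)).eval 1 = k.factorial * 2 ^ k := by
    rw [← factorial_smul_hasseDeriv, LinearMap.smul_apply, eval_smul, ← taylor_coeff, taylor_pow]
    have : taylor (1 : ℝ) (X ^ 2 - 1) = X * (X + C 2) := by
      simp only [taylor_apply, sub_comp, pow_comp, X_comp, one_comp, map_one, map_ofNat]
      ring
    rw [this, mul_pow, coeff_X_pow_mul', if_pos le_rfl, Nat.sub_self, coeff_zero_eq_eval_zero]
    simp
  rw [legendrePoly, eval_mul, eval_C, h]
  field_simp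

lemma DifferentiableAt.hasDerivAt_fst {F : ℝ × ℝ → ℝ} {a b : ℝ}
    (h : DifferentiableAt ℝ F (a, b)) :
    HasDerivAt (fun x => F (x, b)) (fderiv ℝ F (a, b) (1, 0)) a :=
  h.hasFDerivAt.comp_hasDerivAt a ((hasDerivAt_id a).prodMk (hasDerivAt_const a b))

lemma DifferentiableAt.hasDerivAt_snd {F : ℝ × ℝ → ℝ} {a b : ℝ}
    (h : DifferentiableAt ℝ F (a, b)) :
    HasDerivAt (fun y => F (a, y)) (fderiv ℝ F (a, b) (0, 1)) b :=
  h.hasFDerivAt.comp_hasDerivAt b ((hasDerivAt_const b a).prodMk (hasDerivAt_id b))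

lemma ContinuousLinearMap.apply_pair (L : ℝ × ℝ →L[ℝ] ℝ) (a b : ℝ) :
    L (a, b) = a * L (1, 0) + b * L (0, 1) := by
  have : ((a, b) : ℝ × ℝ) = a • (1, 0) + b • (0, 1) := by simp
  rw [this, map_add, map_smul, map_smul, smul_eq_mul, smul_eq_mul]

/-- Green's theorem on a backward light cone for a field with `∂ₛ W = ∂_λ X`. -/
lemma integral_base_eq_integral_characteristics {W X : ℝ × ℝ → ℝ} {r t : ℝ} (ht : 0 < t)
    (htr : t < r)
    (hWc : ContinuousOn W (Ioi (0 : ℝ) ×ˢ Ici (0 : ℝ)))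
    (hXc : ContinuousOn X (Ioi (0 : ℝ) ×ˢ Ici (0 : ℝ)))
    (hW : ∀ a s : ℝ, 0 < a → 0 < s → DifferentiableAt ℝ W (a, s))
    (hX : ∀ a s : ℝ, 0 < a → 0 < s → DifferentiableAt ℝ X (a, s))
    (hWX : ∀ a s : ℝ, 0 < a → 0 < s → fderiv ℝ W (a, s) (0, 1) = fderiv ℝ X (a, s) (1, 0)) :
    ∫ a in (r - t)..(r + t), W (a, 0)
      = (∫ s in (0 : ℝ)..t, (W (r + t - s, s) - X (r + t - s, s)))
        + ∫ s in (0 : ℝ)..t, (W (r - t + s, s) + X (r - t + s, s)) := by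
  set q : ℝ × ℝ → ℝ × ℝ := fun x => (r + (t - x.1) * x.2, x.1) with hq
  have hqd : Differentiable ℝ q := by rw [hq]; fun_prop
  have hqc : Continuous q := hqd.continuous
  have hqpos : ∀ x : ℝ × ℝ, 0 ≤ x.1 → x.1 ≤ t → -1 ≤ x.2 → 0 < r + (t - x.1) * x.2 := by
    intro x h0 h1 h2
    nlinarith
  have hqm : MapsTo q (uIcc 0 t ×ˢ uIcc (-1) 1) (Ioi (0 : ℝ) ×ˢ Ici (0 : ℝ)) := by
    rw [uIcc_of_le ht.le, uIcc_of_le (by norm_num)]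
    rintro x ⟨⟨h1, h2⟩, h3, h4⟩
    exact ⟨hqpos x h1 h2 h3, h1⟩
  set A : ℝ × ℝ → ℝ := fun x => (t - x.1) * W (q x) with hA
  set B : ℝ × ℝ → ℝ := fun x => x.2 * W (q x) - X (q x) with hB
  set I : Set (ℝ × ℝ) := Ioo 0 t ×ˢ Ioo (-1) 1 with hI
  have hWq : ∀ x ∈ I, DifferentiableAt ℝ W (q x) := fun x hx =>
    hW _ _ (hqpos x hx.1.1.le hx.1.2.le hx.2.1.le) hx.1.1
  have hXq : ∀ x ∈ I, DifferentiableAt ℝ X (q x) := fun x hx =>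
    hX _ _ (hqpos x hx.1.1.le hx.1.2.le hx.2.1.le) hx.1.1
  have hAd : ∀ x ∈ I, DifferentiableAt ℝ A x := fun x hx =>
    DifferentiableAt.mul (by fun_prop) ((hWq x hx).comp x hqd.differentiableAt)
  have hBd : ∀ x ∈ I, DifferentiableAt ℝ B x := fun x hx =>
    (DifferentiableAt.mul (by fun_prop) ((hWq x hx).comp x hqd.differentiableAt)).sub
      ((hXq x hx).comp x hqd.differentiableAt)
  have hdiv : ∀ x ∈ I, fderiv ℝ A x (1, 0) + fderiv ℝ B x (0, 1) = 0 := by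
    rintro ⟨s, σ⟩ hx
    have q1 : HasDerivAt (fun s' => q (s', σ)) (-σ, 1) s := by
      refine HasDerivAt.prodMk ?_ (hasDerivAt_id s)
      simpa using (((hasDerivAt_id s).const_sub t).mul_const σ).const_add r
    have q2 : HasDerivAt (fun σ' => q (s, σ')) (t - s, 0) σ := by
      refine HasDerivAt.prodMk ?_ (hasDerivAt_const σ s)
      simpa using ((hasDerivAt_id σ).const_mul (t - s)).const_add r
    have a1 := (hAd _ hx).hasDerivAt_fst.unique
      (((hasDerivAt_id s).const_sub t).mul ((hWq _ hx).hasFDerivAt.comp_hasDerivAt (f := fun s' => q (s', σ)) s q1))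
    have b1 := (hBd _ hx).hasDerivAt_snd.unique
      (((hasDerivAt_id σ).mul ((hWq _ hx).hasFDerivAt.comp_hasDerivAt (f := fun σ' => q (s, σ')) σ q2)).sub
        ((hXq _ hx).hasFDerivAt.comp_hasDerivAt (f := fun σ' => q (s, σ')) σ q2))
    have hc : fderiv ℝ W (q (s, σ)) (0, 1) = fderiv ℝ X (q (s, σ)) (1, 0) :=
      hWX _ _ (hqpos (s, σ) hx.1.1.le hx.1.2.le hx.2.1.le) hx.1.1
    rw [a1, b1, ContinuousLinearMap.apply_pair _ (-σ) 1,
      ContinuousLinearMap.apply_pair _ (t - s) 0, ContinuousLinearMap.apply_pair _ (t - s) 0, hc]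
    simp only [id, Function.comp]
    ring
  have hmin : Ioo (min 0 t) (max 0 t) ×ˢ Ioo (min (-1 : ℝ) 1) (max (-1) 1) = I := by
    rw [min_eq_left ht.le, max_eq_right ht.le, min_eq_left (by norm_num),
      max_eq_right (by norm_num)]
  classical
  have hzero : (fun x => (if x ∈ I then fderiv ℝ A x else 0) (1, 0)
      + (if x ∈ I then fderiv ℝ B x else 0) (0, 1)) = fun _ => (0 : ℝ) := by
    funext x
    by_cases hx : x ∈ I
    · simpa [hx] using hdiv x hx
    · simp [hx]
  have key := integral2_divergence_prod_of_hasFDerivAt A B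
    (fun x => if x ∈ I then fderiv ℝ A x else 0) (fun x => if x ∈ I then fderiv ℝ B x else 0)
    0 (-1) t 1
    (ContinuousOn.mul (by fun_prop) (hWc.comp hqc.continuousOn hqm))
    ((ContinuousOn.mul (by fun_prop) (hWc.comp hqc.continuousOn hqm)).sub
      (hXc.comp hqc.continuousOn hqm))
    (by
      intro x hx
      rw [hmin] at hx
      simpa [hx] using (hAd x hx).hasFDerivAt)
    (by
      intro x hx
      rw [hmin] at hx
      simpa [hx] using (hBd x hx).hasFDerivAt)
    (by rw [hzero]; exact integrableOn_zero)
  have hleft : (∫ x in (0 : ℝ)..t, ∫ y in (-1 : ℝ)..1,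
      ((if (x, y) ∈ I then fderiv ℝ A (x, y) else 0) (1, 0)
      + (if (x, y) ∈ I then fderiv ℝ B (x, y) else 0) (0, 1))) = 0 := by
    have h0 : ∀ x y : ℝ, (if (x, y) ∈ I then fderiv ℝ A (x, y) else 0) (1, 0)
        + (if (x, y) ∈ I then fderiv ℝ B (x, y) else 0) (0, 1) = 0 :=
      fun x y => congrFun hzero (x, y)
    simp only [h0, intervalIntegral.integral_zero]
  rw [hleft] at key
  have hbase : ∫ y in (-1 : ℝ)..1, A (0, y) = ∫ a in (r - t)..(r + t), W (a, 0) := by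
    have := intervalIntegral.smul_integral_comp_add_mul (a := -1) (b := 1)
      (fun a => W (a, 0)) t r
    simp only [hA, hq, sub_zero, intervalIntegral.integral_const_mul]
    rw [smul_eq_mul] at this
    rw [this]
    congr 1 <;> ring
  have htop : ∫ y in (-1 : ℝ)..1, A (t, y) = 0 := by simp [hA]
  have hright : ∫ s in (0 : ℝ)..t, B (s, 1)
      = ∫ s in (0 : ℝ)..t, (W (r + t - s, s) - X (r + t - s, s)) := by
    congr 1; funext s
    simp only [hB, hq, mul_one, one_mul, add_sub_assoc]
  have hleft' : ∫ s in (0 : ℝ)..t, B (s, -1)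
      = -∫ s in (0 : ℝ)..t, (W (r - t + s, s) + X (r - t + s, s)) := by
    rw [← intervalIntegral.integral_neg]
    congr 1; funext s
    have : r + (t - s) * (-1) = r - t + s := by ring
    simp only [hB, hq, this]
    ring
  rw [hbase, htop, hright, hleft'] at key
  linarith

/-- The argument of the Legendre polynomial in the Riemann function with vertex `(r, t)`. -/
noncomputable def riemannArg (r t : ℝ) (q : ℝ × ℝ) : ℝ :=
  (q.1 ^ 2 + r ^ 2 - (t - q.2) ^ 2) / (2 * r * q.1)

lemma hasDerivAt_riemannArg_snd {r a : ℝ} (t s : ℝ) (hr : 0 < r) (ha : 0 < a) :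
    HasDerivAt (fun s => riemannArg r t (a, s)) ((t - s) / (r * a)) s := by
  have h := ((((hasDerivAt_id s).const_sub t).pow 2).const_sub (a ^ 2 + r ^ 2)).div_const
    (2 * r * a)
  refine h.congr_deriv ?_
  simp
  field_simp

lemma hasDerivAt_riemannArg_fst {r a : ℝ} (t s : ℝ) (hr : 0 < r) (ha : 0 < a) :
    HasDerivAt (fun a => riemannArg r t (a, s)) (1 / r - riemannArg r t (a, s) / a) a := by
  have h := ((((hasDerivAt_id a).pow 2).add_const (r ^ 2)).sub_const ((t - s) ^ 2)).div
    ((hasDerivAt_id a).const_mul (2 * r)) (by simp; exact ⟨hr.ne', ha.ne'⟩)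
  refine h.congr_deriv ?_
  simp [riemannArg]
  field_simp

lemma differentiableAt_riemannArg {r : ℝ} (t : ℝ) (hr : 0 < r) {q : ℝ × ℝ} (hq : 0 < q.1) :
    DifferentiableAt ℝ (riemannArg r t) q := by
  unfold riemannArg
  have : 2 * r * q.1 ≠ 0 := by positivity
  fun_prop (disch := assumption)

lemma natCast_mul_pow_pred (m : ℕ) {a : ℝ} (ha : a ≠ 0) :
    (m : ℝ) * a ^ (m - 1) = a ^ m * (m / a) := by
  rcases m with _ | k
  · simp
  · rw [Nat.add_sub_cancel, pow_succ]
    field_simp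

lemma riemannArg_eq_one {r t a s : ℝ} (hr : 0 < r) (ha : 0 < a)
    (h : (a - r) ^ 2 = (t - s) ^ 2) : riemannArg r t (a, s) = 1 := by
  rw [riemannArg, div_eq_one_iff_eq (by positivity)]
  linear_combination h

lemma riemannArg_eikonal {r t a s : ℝ} (hr : 0 < r) (ha : 0 < a) :
    ((t - s) / (r * a)) ^ 2 - (1 / r - riemannArg r t (a, s) / a) ^ 2
      = (1 - riemannArg r t (a, s) ^ 2) / a ^ 2 := by
  simp only [riemannArg]
  field_simp
  ring

open Polynomial in
/-- Riemann's representation formula for `C²` solutions of the radial wave equation in dimension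
`2 m + 1`, where `p` is the Legendre polynomial of degree `m - 1`. -/
lemma radial_wave_representation {m : ℕ} {p : ℝ[X]} (hp1 : p.eval 1 = 1)
    (hode : ∀ z : ℝ, (1 - z ^ 2) * (derivative (derivative p)).eval z
      - 2 * z * (derivative p).eval z + m * (m - 1) * p.eval z = 0)
    {U Ur Ut : ℝ × ℝ → ℝ}
    (hUc : ContinuousOn U (Ioi (0 : ℝ) ×ˢ Ici (0 : ℝ)))
    (hUrc : ContinuousOn Ur (Ioi (0 : ℝ) ×ˢ Ici (0 : ℝ)))
    (hUtc : ContinuousOn Ut (Ioi (0 : ℝ) ×ˢ Ici (0 : ℝ)))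
    (hU : ∀ a s : ℝ, 0 < a → 0 < s → DifferentiableAt ℝ U (a, s))
    (hUr : ∀ a s : ℝ, 0 < a → 0 < s → fderiv ℝ U (a, s) (1, 0) = Ur (a, s))
    (hUt : ∀ a s : ℝ, 0 < a → 0 < s → fderiv ℝ U (a, s) (0, 1) = Ut (a, s))
    (hUrd : ∀ a s : ℝ, 0 < a → 0 < s → DifferentiableAt ℝ Ur (a, s))
    (hUtd : ∀ a s : ℝ, 0 < a → 0 < s → DifferentiableAt ℝ Ut (a, s))
    (hpde : ∀ a s : ℝ, 0 < a → 0 < s →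
      fderiv ℝ Ut (a, s) (0, 1) - fderiv ℝ Ur (a, s) (1, 0) - 2 * m / a * Ur (a, s) = 0)
    {r t : ℝ} (ht : 0 < t) (htr : t < r) :
    2 * (r ^ m * U (r, t)) = (r + t) ^ m * U (r + t, 0) + (r - t) ^ m * U (r - t, 0)
      + ∫ a in (r - t)..(r + t), a ^ m * (p.eval (riemannArg r t (a, 0)) * Ut (a, 0)
        - (derivative p).eval (riemannArg r t (a, 0)) * (t / (r * a)) * U (a, 0)) := by
  have hr : 0 < r := ht.trans htr
  set z := riemannArg r t with hz
  set S := Ioi (0 : ℝ) ×ˢ Ici (0 : ℝ) with hS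
  have hzc : ContinuousOn z S := fun q hq =>
    (differentiableAt_riemannArg t hr hq.1).continuousAt.continuousWithinAt
  have hevalc : ∀ p : ℝ[X], ContinuousOn (fun q => p.eval (z q)) S := fun p =>
    p.continuous.comp_continuousOn hzc
  have hevald : ∀ (p : ℝ[X]) (a s : ℝ), 0 < a → 0 < s →
      DifferentiableAt ℝ (fun q => p.eval (z q)) (a, s) := fun p a s ha _ =>
    DifferentiableAt.comp (a, s) p.differentiable.differentiableAt
      (differentiableAt_riemannArg (q := (a, s)) t hr ha)
  set W : ℝ × ℝ → ℝ := fun q => q.1 ^ m * (p.eval (z q) * Ut q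
    - (derivative p).eval (z q) * ((t - q.2) / (r * q.1)) * U q) with hW
  set X : ℝ × ℝ → ℝ := fun q => q.1 ^ m * (p.eval (z q) * (Ur q + m / q.1 * U q)
    - (derivative p).eval (z q) * (1 / r - z q / q.1) * U q) with hX
  have hWc : ContinuousOn W S := by
    have h1 := hevalc p
    have h2 := hevalc (derivative p)
    have h3 : ∀ q ∈ S, r * q.1 ≠ 0 := fun q hq => (mul_pos hr hq.1).ne'
    rw [hW]
    fun_prop (disch := assumption)
  have hXc : ContinuousOn X S := by
    have h1 := hevalc p
    have h2 := hevalc (derivative p)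
    have h3 : ∀ q ∈ S, q.1 ≠ 0 := fun q hq => ne_of_gt hq.1
    rw [hX]
    fun_prop (disch := assumption)
  have hWd : ∀ a s : ℝ, 0 < a → 0 < s → DifferentiableAt ℝ W (a, s) := by
    intro a s ha hs
    have h1 := hevald p a s ha hs
    have h2 := hevald (derivative p) a s ha hs
    have h3 : r * (a, s).1 ≠ 0 := (mul_pos hr ha).ne'
    have h4 := hU a s ha hs
    have h5 := hUtd a s ha hs
    rw [hW]
    fun_prop (disch := assumption)
  have hXd : ∀ a s : ℝ, 0 < a → 0 < s → DifferentiableAt ℝ X (a, s) := by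
    intro a s ha hs
    have h1 := hevald p a s ha hs
    have h2 := hevald (derivative p) a s ha hs
    have h3 : (a, s).1 ≠ 0 := ha.ne'
    have h4 := hU a s ha hs
    have h5 := hUrd a s ha hs
    have h6 : DifferentiableAt ℝ z (a, s) := differentiableAt_riemannArg t hr ha
    rw [hX]
    fun_prop (disch := assumption)
  have hWX : ∀ a s : ℝ, 0 < a → 0 < s →
      fderiv ℝ W (a, s) (0, 1) = fderiv ℝ X (a, s) (1, 0) := by
    intro a s ha hs
    have hzs : HasDerivAt (fun s => z (a, s)) ((t - s) / (r * a)) s :=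
      hasDerivAt_riemannArg_snd t s hr ha
    have hza : HasDerivAt (fun a => z (a, s)) (1 / r - z (a, s) / a) a :=
      hasDerivAt_riemannArg_fst t s hr ha
    have hps : ∀ p : ℝ[X], HasDerivAt (fun s => p.eval (z (a, s)))
        ((derivative p).eval (z (a, s)) * ((t - s) / (r * a))) s := fun p =>
      HasDerivAt.comp (h₂ := fun x => p.eval x) s (p.hasDerivAt (z (a, s))) hzs
    have hpa : ∀ p : ℝ[X], HasDerivAt (fun a => p.eval (z (a, s)))
        ((derivative p).eval (z (a, s)) * (1 / r - z (a, s) / a)) a := fun p =>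
      HasDerivAt.comp (h₂ := fun x => p.eval x) a (p.hasDerivAt (z (a, s))) hza
    have hUs := (hU a s ha hs).hasDerivAt_snd
    have hUa := (hU a s ha hs).hasDerivAt_fst
    rw [hUt a s ha hs] at hUs
    rw [hUr a s ha hs] at hUa
    have hUts := (hUtd a s ha hs).hasDerivAt_snd
    have hUra := (hUrd a s ha hs).hasDerivAt_fst
    have w1 := (hWd a s ha hs).hasDerivAt_snd.unique
      ((((hps p).mul hUts).sub (((hps (derivative p)).mul
        (((hasDerivAt_id s).const_sub t).div_const (r * a))).mul hUs)).const_mul (a ^ m))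
    have x1 := (hXd a s ha hs).hasDerivAt_fst.unique
      (((hasDerivAt_id a).pow m).mul (((hpa p).mul (hUra.add
        (((hasDerivAt_const a (m : ℝ)).div (hasDerivAt_id a) ha.ne').mul hUa))).sub
        (((hpa (derivative p)).mul ((hza.div (hasDerivAt_id a) ha.ne').const_sub (1 / r))).mul hUa)))
    rw [w1, x1]
    have hzaa : ((1 / r - z (a, s) / a) * a - z (a, s) * 1) / a ^ 2
        = 1 / (r * a) - 2 * z (a, s) / a ^ 2 := by
      field_simp
      ring
    have heik : ((t - s) / (r * a)) ^ 2 - (1 / r - z (a, s) / a) ^ 2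
        = (1 - z (a, s) ^ 2) / a ^ 2 := riemannArg_eikonal hr ha
    simp only [id, Pi.mul_apply, Pi.add_apply, Pi.div_apply, Pi.pow_apply]
    rw [natCast_mul_pow_pred m ha.ne', hzaa]
    generalize z (a, s) = ζ at *
    have ho := hode ζ
    have hpd := hpde a s ha hs
    linear_combination a ^ m * p.eval ζ * hpd
      - U (a, s) * a ^ m * (derivative (derivative p)).eval ζ * heik
      - U (a, s) * a ^ m / a ^ 2 * ho
  have hgreen := integral_base_eq_integral_characteristics ht htr hWc hXc hWd hXd hWX
  have hplus : ∫ s in (0 : ℝ)..t, (W (r + t - s, s) - X (r + t - s, s))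
      = r ^ m * U (r, t) - (r + t) ^ m * U (r + t, 0) := by
    have hmaps : MapsTo (fun s : ℝ => (r + t - s, s)) (Icc 0 t) S := fun s hs =>
      ⟨by simp only [mem_Ioi]; linarith [hs.2], hs.1⟩
    have hcont : Continuous fun s : ℝ => (r + t - s, s) := by fun_prop
    have hc : ContinuousOn (fun s => W (r + t - s, s) - X (r + t - s, s)) (Icc 0 t) :=
      (hWc.comp hcont.continuousOn hmaps).sub (hXc.comp hcont.continuousOn hmaps)
    have := intervalIntegral.integral_eq_sub_of_hasDerivAt_of_le ht.le
      (f := fun s => (r + t - s) ^ m * U (r + t - s, s))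
      (f' := fun s => W (r + t - s, s) - X (r + t - s, s))
      (ContinuousOn.mul (by fun_prop) (hUc.comp hcont.continuousOn hmaps)) ?_
      (hc.intervalIntegrable_of_Icc ht.le)
    · rw [this]
      simp
    · intro s hs
      have ha : 0 < r + t - s := by linarith [hs.2]
      have hone : z (r + t - s, s) = 1 := riemannArg_eq_one hr ha (by ring)
      have hline : HasDerivAt (fun s => (r + t - s)) (-1) s := by
        simpa using (hasDerivAt_id s).const_sub (r + t)
      have hd := (hline.pow m).mul ((hU _ s ha hs.1).hasFDerivAt.comp_hasDerivAt
        (f := fun s => (r + t - s, s)) s (hline.prodMk (hasDerivAt_id s)))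
      refine hd.congr_deriv ?_
      rw [ContinuousLinearMap.apply_pair, hUr _ s ha hs.1, hUt _ s ha hs.1]
      simp only [hW, hX, hone, hp1, Function.comp, Pi.pow_apply]
      have hchar : (t - s) / (r * (r + t - s)) = 1 / r - 1 / (r + t - s) := by
        field_simp
        ring
      rw [natCast_mul_pow_pred m ha.ne', hchar]
      ring
  have hminus : ∫ s in (0 : ℝ)..t, (W (r - t + s, s) + X (r - t + s, s))
      = r ^ m * U (r, t) - (r - t) ^ m * U (r - t, 0) := by
    have hmaps : MapsTo (fun s : ℝ => (r - t + s, s)) (Icc 0 t) S := fun s hs =>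
      ⟨by simp only [mem_Ioi]; linarith [hs.1], hs.1⟩
    have hcont : Continuous fun s : ℝ => (r - t + s, s) := by fun_prop
    have hc : ContinuousOn (fun s => W (r - t + s, s) + X (r - t + s, s)) (Icc 0 t) :=
      (hWc.comp hcont.continuousOn hmaps).add (hXc.comp hcont.continuousOn hmaps)
    have := intervalIntegral.integral_eq_sub_of_hasDerivAt_of_le ht.le
      (f := fun s => (r - t + s) ^ m * U (r - t + s, s))
      (f' := fun s => W (r - t + s, s) + X (r - t + s, s))
      (ContinuousOn.mul (by fun_prop) (hUc.comp hcont.continuousOn hmaps)) ?_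
      (hc.intervalIntegrable_of_Icc ht.le)
    · rw [this]
      simp
    · intro s hs
      have ha : 0 < r - t + s := by linarith [hs.1]
      have hone : z (r - t + s, s) = 1 := riemannArg_eq_one hr ha (by ring)
      have hline : HasDerivAt (fun s => (r - t + s)) 1 s := (hasDerivAt_id s).const_add (r - t)
      have hd := (hline.pow m).mul ((hU _ s ha hs.1).hasFDerivAt.comp_hasDerivAt
        (f := fun s => (r - t + s, s)) s (hline.prodMk (hasDerivAt_id s)))
      refine hd.congr_deriv ?_
      rw [ContinuousLinearMap.apply_pair, hUr _ s ha hs.1, hUt _ s ha hs.1]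
      simp only [hW, hX, hone, hp1, Function.comp, Pi.pow_apply]
      have hchar : (t - s) / (r * (r - t + s)) = -(1 / r - 1 / (r - t + s)) := by
        field_simp
        ring
      rw [natCast_mul_pow_pred m ha.ne', hchar]
      ring
  rw [hplus, hminus] at hgreen
  simp only [hW, sub_zero] at hgreen
  linarith

/-- Positivity of both data terms lets the Legendre weights be replaced by constants. -/
lemma integrand_lower_bound {P P' c x fa ga r t a : ℝ} (hP : 1 / 2 ≤ P) (hP' : P' ≤ c / 2)
    (hc : 0 ≤ c) (hf : 0 ≤ fa) (hg : 0 ≤ ga) (hr : 0 < r) (ht : 0 ≤ t) (htr : t ≤ r)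
    (ha : 0 < a) (hx : 0 ≤ x) :
    1 / 2 * (x * (-c * fa / a + ga)) ≤ x * (P * ga - P' * (t / (r * a)) * fa) := by
  have h1 : 1 / 2 * ga ≤ P * ga := mul_le_mul_of_nonneg_right hP hg
  have hk : 0 ≤ t / (r * a) := by positivity
  have hk' : t / (r * a) ≤ 1 / a := by
    rw [div_le_div_iff₀ (by positivity) ha]
    nlinarith
  have h2 : P' * (t / (r * a)) ≤ c / 2 * (1 / a) :=
    (mul_le_mul_of_nonneg_right hP' hk).trans
      (mul_le_mul_of_nonneg_left hk' (by positivity))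
  have h3 := mul_le_mul_of_nonneg_right h2 hf
  have h4 : 1 / 2 * (-c * fa / a + ga) ≤ P * ga - P' * (t / (r * a)) * fa := by
    have : 1 / 2 * (-c * fa / a + ga) = 1 / 2 * ga - c / 2 * (1 / a) * fa := by ring
    linarith
  calc 1 / 2 * (x * (-c * fa / a + ga)) = x * (1 / 2 * (-c * fa / a + ga)) := by ring
    _ ≤ _ := mul_le_mul_of_nonneg_left h4 hx

lemma riemannArg_mem {r t η a : ℝ} (ht : 0 < t) (hη : 0 < η) (htr : 2 / η * t ≤ r - t)
    (h1 : r - t ≤ a) (h2 : a ≤ r + t) :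
    1 / (1 + η) ≤ riemannArg r t (a, 0) ∧ riemannArg r t (a, 0) ≤ 1 := by
  have hpos : 0 < r - t := lt_of_lt_of_le (by positivity) htr
  have hr : 0 < r := by linarith
  have ha : 0 < a := by linarith
  have hη' : 2 * t ≤ (r - t) * η := by
    rw [div_mul_eq_mul_div, div_le_iff₀ hη] at htr
    exact htr
  have hden : 0 < 2 * r * a := by positivity
  simp only [riemannArg, sub_zero]
  constructor
  · have hr' : r ≤ (r - t) * (1 + η) := by nlinarith
    have hmid : 2 * (r - t) * a ≤ a ^ 2 + r ^ 2 - t ^ 2 := by nlinarith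
    rw [div_le_div_iff₀ (by positivity) hden]
    have := mul_le_mul_of_nonneg_right hmid (by positivity : 0 ≤ 1 + η)
    have := mul_le_mul_of_nonneg_right hr' (by positivity : 0 ≤ 2 * a)
    linarith
  · rw [div_le_one hden]
    nlinarith

/-- the lower bound for the free radial wave solution in odd
space dimensions `n = 2m + 1`, `m ≥ 2`, on the set `Σ₁`. -/
theorem stmt_7 (m n : ℕ) (hm : 2 ≤ m) (hn : n = 2 * m + 1)
    (κ : ℝ) (hκ0 : 0 < κ)
    (f g : ℝ → ℝ)
    (hf : ContDiffOn ℝ 2 f (Ioi (0 : ℝ))) (hg : ContDiffOn ℝ 1 g (Ioi (0 : ℝ)))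
    (R : ℝ) (hR : 0 < R)
    (hdata :
      (∃ C₁ : ℝ, 0 < C₁ ∧ ∀ r : ℝ, R ≤ r →
        C₁ / (1 + r) ^ κ ≤ f r ∧ 0 < g r ∧
        0 < -((m : ℝ) * ((m : ℝ) - 1)) * f r / r + g r) ∨
      (∃ C₂ : ℝ, 0 < C₂ ∧ ∀ r : ℝ, R ≤ r →
        0 < f r ∧ 0 < g r ∧
        C₂ / (1 + r) ^ (1 + κ) ≤ -((m : ℝ) * ((m : ℝ) - 1)) * f r / r + g r))
    (η : ℝ) (hη0 : 0 < η) (hη1 : η ≤ 1)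
    (hP : ∀ z : ℝ, 1 / (1 + η) ≤ z → z ≤ 1 →
      1 / 2 ≤ legendreP (m - 1) z ∧ 0 < deriv (legendreP (m - 1)) z ∧
      deriv (legendreP (m - 1)) z ≤ (m : ℝ) * ((m : ℝ) - 1) / 2)
    (δ : ℝ) (hδ : 2 / η ≤ δ)
    (u₀ : ℝ → ℝ → ℝ)
    (hu₀ : ContDiffOn ℝ 2 (fun q : ℝ × ℝ => u₀ q.1 q.2) (Ioi (0 : ℝ) ×ˢ Ici (0 : ℝ)))
    (hpde : ∀ r : ℝ, 0 < r → ∀ t : ℝ, 0 ≤ t →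
      deriv (deriv (u₀ r)) t - deriv (fun s => deriv (fun s' => u₀ s' t) s) r -
        ((n : ℝ) - 1) / r * deriv (fun s => u₀ s t) r = 0)
    (hic1 : ∀ r : ℝ, 0 < r → u₀ r 0 = f r)
    (hic2 : ∀ r : ℝ, 0 < r → deriv (u₀ r) 0 = g r) :
    ∀ r t : ℝ, 0 < r → 0 < t → 0 < max R (δ * t) → max R (δ * t) ≤ r - t →
      (1 / (2 * r ^ m)) * (f (r + t) * (r + t) ^ m + f (r - t) * (r - t) ^ m) +
        (1 / (4 * r ^ m)) *
          ∫ lam in (r - t)..(r + t),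
            lam ^ m * (-((m : ℝ) * ((m : ℝ) - 1)) * f lam / lam + g lam)
      ≤ u₀ r t := by
  intro r t hr ht _ hmax
  have hRrt : R ≤ r - t := (le_max_left _ _).trans hmax
  have hδrt : 2 / η * t ≤ r - t :=
    (mul_le_mul_of_nonneg_right hδ ht.le).trans ((le_max_right _ _).trans hmax)
  have htr : t < r := by linarith
  have hm1 : (1 : ℝ) ≤ m := by exact_mod_cast (by omega : 1 ≤ m)
  have hfpos : ∀ a, R ≤ a → 0 ≤ f a := by
    intro a ha
    rcases hdata with ⟨C, hC, h⟩ | ⟨C, hC, h⟩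
    · have : 0 < 1 + a := by linarith
      exact le_trans (by positivity) (h a ha).1
    · exact (h a ha).1.le
  have hgpos : ∀ a, R ≤ a → 0 < g a := by
    intro a ha
    rcases hdata with ⟨C, hC, h⟩ | ⟨C, hC, h⟩ <;> exact (h a ha).2.1
  set S := Ioi (0 : ℝ) ×ˢ Ici (0 : ℝ) with hS
  set U : ℝ × ℝ → ℝ := fun q => u₀ q.1 q.2 with hU
  have hSu : UniqueDiffOn ℝ S := isOpen_Ioi.uniqueDiffOn.prod (uniqueDiffOn_Ici 0)
  have hDc : ContDiffOn ℝ 1 (fderivWithin ℝ U S) S := hu₀.fderivWithin hSu (by norm_num)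
  have hSn : ∀ a s : ℝ, 0 < a → 0 < s → S ∈ nhds (a, s) := fun a s ha hs =>
    prod_mem_nhds (Ioi_mem_nhds ha) (Ici_mem_nhds hs)
  have hUd : ∀ a s : ℝ, 0 < a → 0 < s → DifferentiableAt ℝ U (a, s) := fun a s ha hs =>
    (hu₀.contDiffAt (hSn a s ha hs)).differentiableAt (by norm_num)
  have hDd : ∀ a s : ℝ, 0 < a → 0 < s → DifferentiableAt ℝ (fderivWithin ℝ U S) (a, s) :=
    fun a s ha hs => (hDc.contDiffAt (hSn a s ha hs)).differentiableAt (by norm_num)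
  have hDeq : ∀ a s : ℝ, 0 < a → 0 < s → fderivWithin ℝ U S (a, s) = fderiv ℝ U (a, s) :=
    fun a s ha hs => fderivWithin_of_mem_nhds (hSn a s ha hs)
  set Ur : ℝ × ℝ → ℝ := fun q => fderivWithin ℝ U S q (1, 0) with hUr
  set Ut : ℝ × ℝ → ℝ := fun q => fderivWithin ℝ U S q (0, 1) with hUt
  have hUrd : ∀ a s : ℝ, 0 < a → 0 < s → DifferentiableAt ℝ Ur (a, s) := fun a s ha hs =>
    (hDd a s ha hs).clm_apply (differentiableAt_const _)
  have hUtd : ∀ a s : ℝ, 0 < a → 0 < s → DifferentiableAt ℝ Ut (a, s) := fun a s ha hs =>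
    (hDd a s ha hs).clm_apply (differentiableAt_const _)
  have hur : ∀ a s : ℝ, 0 < a → 0 < s → deriv (fun x => u₀ x s) a = Ur (a, s) := by
    intro a s ha hs
    simp only [hUr, hDeq a s ha hs]
    exact (hUd a s ha hs).hasDerivAt_fst.deriv
  have hut : ∀ a s : ℝ, 0 < a → 0 < s → deriv (u₀ a) s = Ut (a, s) := by
    intro a s ha hs
    simp only [hUt, hDeq a s ha hs]
    exact (hUd a s ha hs).hasDerivAt_snd.deriv
  have hwave : ∀ a s : ℝ, 0 < a → 0 < s →
      fderiv ℝ Ut (a, s) (0, 1) - fderiv ℝ Ur (a, s) (1, 0) - 2 * m / a * Ur (a, s) = 0 := by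
    intro a s ha hs
    have h := hpde a ha s hs.le
    have h1 : deriv (deriv (u₀ a)) s = fderiv ℝ Ut (a, s) (0, 1) := by
      rw [← (hUtd a s ha hs).hasDerivAt_snd.deriv]
      refine Filter.EventuallyEq.deriv_eq ?_
      filter_upwards [Ioi_mem_nhds hs] with y hy using hut a y ha hy
    have h2 : deriv (fun x => deriv (fun y => u₀ y s) x) a = fderiv ℝ Ur (a, s) (1, 0) := by
      rw [← (hUrd a s ha hs).hasDerivAt_fst.deriv]
      refine Filter.EventuallyEq.deriv_eq ?_
      filter_upwards [Ioi_mem_nhds ha] with y hy using hur y s hy hs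
    rw [h1, h2, hur a s ha hs, hn] at h
    push_cast at h
    linear_combination h
  have hUt0 : ∀ a : ℝ, R ≤ a → Ut (a, 0) = g a := by
    intro a ha
    have ha0 : 0 < a := hR.trans_le ha
    have hdiff : DifferentiableAt ℝ (u₀ a) 0 := by
      by_contra hnot
      have := hic2 a ha0
      rw [deriv_zero_of_not_differentiableAt hnot] at this
      exact (hgpos a ha).ne this
    have hmem : ((a, 0) : ℝ × ℝ) ∈ S := ⟨ha0, self_mem_Ici⟩
    have hF := ((hu₀.differentiableOn (by norm_num)) (a, 0) hmem).hasFDerivWithinAt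
    have hline : HasDerivWithinAt (fun s : ℝ => (a, s)) (0, 1) (Ici 0) 0 :=
      ((hasDerivAt_const (0 : ℝ) a).prodMk (hasDerivAt_id 0)).hasDerivWithinAt
    have h1 : HasDerivWithinAt (u₀ a) (Ut (a, 0)) (Ici 0) 0 :=
      hF.comp_hasDerivWithinAt (f := fun s : ℝ => (a, s)) 0 hline fun s hs => ⟨ha0, hs⟩
    have h2 : HasDerivWithinAt (u₀ a) (g a) (Ici 0) 0 := by
      rw [← hic2 a ha0]
      exact hdiff.hasDerivAt.hasDerivWithinAt
    exact (uniqueDiffOn_Ici 0 0 self_mem_Ici).eq_deriv _ h1 h2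
  have hcast : ((m - 1 : ℕ) : ℝ) = m - 1 := by
    rw [Nat.cast_sub (by omega), Nat.cast_one]
  have hrep := radial_wave_representation (m := m) (legendrePoly_eval_one (m - 1))
    (fun z => by
      have := legendrePoly_ode (m - 1) z
      rw [hcast] at this
      linear_combination this)
    hu₀.continuousOn (hDc.continuousOn.clm_apply continuousOn_const)
    (hDc.continuousOn.clm_apply continuousOn_const) hUd
    (fun a s ha hs => by simp only [hDeq a s ha hs])
    (fun a s ha hs => by simp only [hDeq a s ha hs]) hUrd hUtd hwave ht htr
  have hab : r - t ≤ r + t := by linarith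
  have hpos : ∀ a ∈ Icc (r - t) (r + t), 0 < a := fun a ha => by linarith [ha.1]
  have hsub : Icc (r - t) (r + t) ⊆ Ioi 0 := hpos
  have hmono : ∫ a in (r - t)..(r + t),
        1 / 2 * (a ^ m * (-((m : ℝ) * ((m : ℝ) - 1)) * f a / a + g a))
      ≤ ∫ a in (r - t)..(r + t), a ^ m *
        ((legendrePoly (m - 1)).eval (riemannArg r t (a, 0)) * Ut (a, 0)
        - (Polynomial.derivative (legendrePoly (m - 1))).eval (riemannArg r t (a, 0))
          * (t / (r * a)) * U (a, 0)) := by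
    refine intervalIntegral.integral_mono_on hab ?_ ?_ ?_
    · refine ContinuousOn.intervalIntegrable_of_Icc hab ?_
      have h1 := hf.continuousOn.mono hsub
      have h2 := hg.continuousOn.mono hsub
      have h3 : ∀ a ∈ Icc (r - t) (r + t), a ≠ 0 := fun a ha => (hpos a ha).ne'
      fun_prop (disch := assumption)
    · refine ContinuousOn.intervalIntegrable_of_Icc hab ?_
      have hbase : ContinuousOn (fun a : ℝ => (a, (0 : ℝ))) (Icc (r - t) (r + t)) := by fun_prop
      have hmaps : MapsTo (fun a : ℝ => (a, (0 : ℝ))) (Icc (r - t) (r + t)) S := fun a ha =>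
        ⟨hpos a ha, self_mem_Ici⟩
      have h1 : ContinuousOn (fun a => Ut (a, 0)) (Icc (r - t) (r + t)) :=
        (hDc.continuousOn.clm_apply continuousOn_const).comp hbase hmaps
      have h2 : ContinuousOn (fun a => U (a, 0)) (Icc (r - t) (r + t)) :=
        hu₀.continuousOn.comp hbase hmaps
      have h3 : ∀ a ∈ Icc (r - t) (r + t), r * a ≠ 0 := fun a ha =>
        (mul_pos hr (hpos a ha)).ne'
      have h4 : ContinuousOn (fun a => riemannArg r t (a, 0)) (Icc (r - t) (r + t)) :=
        fun a ha => ContinuousAt.continuousWithinAt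
          (hasDerivAt_riemannArg_fst t 0 hr (hpos a ha)).continuousAt
      have h5 : ∀ p : Polynomial ℝ, ContinuousOn (fun a => p.eval (riemannArg r t (a, 0)))
          (Icc (r - t) (r + t)) := fun p => p.continuous.comp_continuousOn h4
      exact (continuousOn_id.pow m).mul (((h5 _).mul h1).sub
        (((h5 _).mul (continuousOn_const.div (by fun_prop) h3)).mul h2))
    · intro a ha
      have ha0 := hpos a ha
      have haR : R ≤ a := hRrt.trans ha.1
      obtain ⟨hz1, hz2⟩ := riemannArg_mem ht hη0 hδrt ha.1 ha.2
      obtain ⟨hP1, -, hP3⟩ := hP _ hz1 hz2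
      rw [legendreP_eq_eval] at hP1 hP3
      rw [Polynomial.deriv] at hP3
      rw [hUt0 a haR, show U (a, 0) = f a from hic1 a ha0]
      exact integrand_lower_bound hP1 hP3 (mul_nonneg (by linarith) (by linarith))
        (hfpos a haR) (hgpos a haR).le hr ht.le htr.le ha0 (by positivity)
  rw [intervalIntegral.integral_const_mul] at hmono
  have hfp : U (r + t, 0) = f (r + t) := hic1 _ (by linarith)
  have hfm : U (r - t, 0) = f (r - t) := hic1 _ (by linarith)
  rw [hfp, hfm] at hrep
  have hu : U (r, t) = u₀ r t := rfl
  rw [hu] at hrep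
  have hrm : 0 < r ^ m := by positivity
  set J := ∫ a in (r - t)..(r + t), a ^ m * (-((m : ℝ) * ((m : ℝ) - 1)) * f a / a + g a)
  have hsplit : 1 / (2 * r ^ m) * (f (r + t) * (r + t) ^ m + f (r - t) * (r - t) ^ m)
      + 1 / (4 * r ^ m) * J
      = (f (r + t) * (r + t) ^ m + f (r - t) * (r - t) ^ m + 1 / 2 * J) / (2 * r ^ m) := by
    field_simp
    ring
  rw [hsplit, div_le_iff₀ (by positivity)]
  linarith
end

section
/- Let n = 2m with m ≥ 2 an integer, and let 0 < κ. Let ζ ∈ (0,1] be a constant such that 1/2 ≤ T_{m−1}(z) ≤ 1 and 0 < T'_{m−1}(z) ≤ (m−1)² for all z with 1/(1+ζ) ≤ z ≤ 1, set C_{2,m} = m − 3/8 + 5ζ(m−1)²/3, and let δ ≥ 2/ζ. Suppose f ∈ C²((0,∞)) and g ∈ C¹((0,∞)) satisfy, for some R > 0 and C₃ > 0: f(r) > 0, g(r) > 0 and −C_{2,m}·f(r)/r − |f'(r)| + g(r)/2 ≥ C₃/(1+r)^{1+κ} for all r ≥ R. If u⁰ ∈ C²((0,∞) × [0,∞)) is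 a classical solution of u⁰_tt − u⁰_rr − ((n−1)/r)·u⁰_r = 0 with u⁰(r,0) = f(r) and u⁰_t(r,0) = g(r), then for all (r,t) ∈ Σ₁: u⁰(r,t) ≥ (1/(π r^{m−1}))·∫₀ᵗ (ρ/√(t²−ρ²))·∫_{r−ρ}^{r+ρ} {−2C_{2,m}·f(λ)/λ − 2|f'(λ)| + g(λ)}·λ^m / (√(λ²−(r−ρ)²)·√((r+ρ)²−λ²)) dλ dρ. -/
open MeasureTheory Set

/-- Evaluation of the Chebyshev polynomial of the first kind. -/
noncomputable def chebT (k : ℤ) (z : ℝ) : ℝ := (Polynomial.Chebyshev.T ℝ k).eval z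

/-- Evaluation of the derivative of the Chebyshev polynomial of the first kind. -/
noncomputable def chebT' (k : ℤ) (z : ℝ) : ℝ :=
  (Polynomial.derivative (Polynomial.Chebyshev.T ℝ k)).eval z

open Real in
/-- The angular average `∫₀^{π/2} cos^{2k} θ · φ(z cos² θ + sin² θ) dθ`. -/
noncomputable def angularAvg (φ : ℝ → ℝ) (k : ℕ) (z : ℝ) : ℝ :=
  ∫ θ in (0 : ℝ)..π / 2, cos θ ^ (2 * k) * φ (z * cos θ ^ 2 + sin θ ^ 2)

theorem neg_one_lt_mix {z : ℝ} (hz : -1 < z) (θ : ℝ) :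
    -1 < z * Real.cos θ ^ 2 + Real.sin θ ^ 2 := by
  have h := Real.sin_sq_add_cos_sq θ
  rcases (sq_nonneg (Real.cos θ)).eq_or_lt with h0 | h0
  · rw [← h0] at h ⊢; nlinarith
  · nlinarith [sq_nonneg (Real.sin θ)]

theorem continuous_angularIntegrand {φ : ℝ → ℝ} (hφ : ContinuousOn φ (Ioi (-1))) (k : ℕ)
    {z : ℝ} (hz : -1 < z) :
    Continuous fun θ => Real.cos θ ^ (2 * k) * φ (z * Real.cos θ ^ 2 + Real.sin θ ^ 2) := by
  refine (by fun_prop : Continuous fun θ => Real.cos θ ^ (2 * k)).mul ?_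
  exact hφ.comp_continuous (by fun_prop) fun θ => neg_one_lt_mix hz θ

theorem hasDerivAt_angularAvg {φ φ' : ℝ → ℝ} (hφ : ∀ w, -1 < w → HasDerivAt φ (φ' w) w)
    (hφ' : ContinuousOn φ' (Ioi (-1))) (k : ℕ) {z : ℝ} (hz : -1 < z) :
    HasDerivAt (angularAvg φ k) (angularAvg φ' (k + 1) z) z := by
  have hφc : ContinuousOn φ (Ioi (-1)) := fun w hw => (hφ w hw).continuousAt.continuousWithinAt
  set lo : ℝ := min ((z - 1) / 2) 1
  set hi : ℝ := max (z + 1) 1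
  have hlo : -1 < lo := lt_min (by linarith) (by norm_num)
  obtain ⟨M, hM⟩ := (isCompact_Icc (a := lo) (b := hi)).exists_bound_of_continuousOn
    (hφ'.mono fun w hw => hlo.trans_le hw.1)
  have hs : Ioo ((z - 1) / 2) (z + 1) ∈ nhds z := Ioo_mem_nhds (by linarith) (by linarith)
  refine (intervalIntegral.hasDerivAt_integral_of_dominated_loc_of_deriv_le
    (F := fun z θ => Real.cos θ ^ (2 * k) * φ (z * Real.cos θ ^ 2 + Real.sin θ ^ 2))
    (F' := fun z θ => Real.cos θ ^ (2 * (k + 1)) * φ' (z * Real.cos θ ^ 2 + Real.sin θ ^ 2))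
    (bound := fun _ => M) hs ?_ ?_ ?_ ?_ ?_ ?_).2
  · filter_upwards [hs] with y hy
    exact (continuous_angularIntegrand hφc k (by linarith [hy.1])).aestronglyMeasurable
  · exact (continuous_angularIntegrand hφc k hz).intervalIntegrable _ _
  · exact (continuous_angularIntegrand hφ' (k + 1) hz).aestronglyMeasurable
  · refine .of_forall fun θ _ y hy => ?_
    have h1 := Real.sin_sq_add_cos_sq θ
    have hc := sq_nonneg (Real.cos θ)
    have hs := sq_nonneg (Real.sin θ)
    have hmem : y * Real.cos θ ^ 2 + Real.sin θ ^ 2 ∈ Icc lo hi := by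
      have e1 : lo ≤ y := (min_le_left _ _).trans hy.1.le
      have e2 : lo ≤ 1 := min_le_right _ _
      have e3 : y ≤ hi := hy.2.le.trans (le_max_left _ _)
      have e4 : 1 ≤ hi := le_max_right _ _
      constructor <;> nlinarith
    have hb := hM _ hmem
    have hp : Real.cos θ ^ (2 * (k + 1)) ≤ 1 := by
      rw [pow_mul]; exact pow_le_one₀ hc (by linarith)
    have hp0 : 0 ≤ Real.cos θ ^ (2 * (k + 1)) := by rw [pow_mul]; positivity
    rw [norm_mul, Real.norm_of_nonneg hp0]
    exact (mul_le_of_le_one_left (norm_nonneg _) hp).trans hb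
  · exact intervalIntegrable_const
  · refine .of_forall fun θ _ y hy => ?_
    have h2 := (hφ _ (neg_one_lt_mix (by linarith [hy.1] : -1 < y) θ)).comp y
      (((hasDerivAt_id y).mul_const (Real.cos θ ^ 2)).add_const (Real.sin θ ^ 2))
    refine (h2.const_mul (Real.cos θ ^ (2 * k))).congr_deriv ?_
    ring

/-- If `φ` solves `(1 - w²) φ'' + (1 - 2w) φ' + c φ = 0`, then its angular average solves
Legendre's equation `(1 - z²) K'' - 2 z K' + c K = 0`. -/
theorem angularAvg_legendre {φ φ' φ'' : ℝ → ℝ} {c : ℝ}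
    (hφ : ∀ w, -1 < w → HasDerivAt φ (φ' w) w)
    (hφ' : ∀ w, -1 < w → HasDerivAt φ' (φ'' w) w) (hφ'' : ContinuousOn φ'' (Ioi (-1)))
    (hode : ∀ w, -1 < w → (1 - w ^ 2) * φ'' w + (1 - 2 * w) * φ' w + c * φ w = 0)
    {z : ℝ} (hz : -1 < z) :
    (1 - z ^ 2) * angularAvg φ'' 2 z - 2 * z * angularAvg φ' 1 z + c * angularAvg φ 0 z = 0 := by
  have hφc : ContinuousOn φ (Ioi (-1)) := fun w hw => (hφ w hw).continuousAt.continuousWithinAt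
  have hφc' : ContinuousOn φ' (Ioi (-1)) := fun w hw => (hφ' w hw).continuousAt.continuousWithinAt
  have i0 := ((continuous_angularIntegrand hφc 0 hz).intervalIntegrable
    (μ := volume) 0 (Real.pi / 2)).const_mul c
  have i1 := ((continuous_angularIntegrand hφc' 1 hz).intervalIntegrable
    (μ := volume) 0 (Real.pi / 2)).const_mul (2 * z)
  have i2 := ((continuous_angularIntegrand hφ'' 2 hz).intervalIntegrable
    (μ := volume) 0 (Real.pi / 2)).const_mul (1 - z ^ 2)
  unfold angularAvg
  rw [← intervalIntegral.integral_const_mul, ← intervalIntegral.integral_const_mul,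
    ← intervalIntegral.integral_const_mul, ← intervalIntegral.integral_sub i2 i1,
    ← intervalIntegral.integral_add (i2.sub i1) i0]
  rw [intervalIntegral.integral_eq_sub_of_hasDerivAt
    (f := fun θ => -(φ' (z * Real.cos θ ^ 2 + Real.sin θ ^ 2) * (Real.sin θ * Real.cos θ)))]
  · simp
  · intro θ _
    have hw := neg_one_lt_mix hz θ
    have hd : HasDerivAt (fun θ => z * Real.cos θ ^ 2 + Real.sin θ ^ 2)
        (2 * (1 - z) * (Real.sin θ * Real.cos θ)) θ := by
      refine ((((Real.hasDerivAt_cos θ).pow 2).const_mul z).add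
        ((Real.hasDerivAt_sin θ).pow 2)).congr_deriv ?_
      simp; ring
    refine (((hφ' _ hw).comp θ hd).mul
      ((Real.hasDerivAt_sin θ).mul (Real.hasDerivAt_cos θ))).neg.congr_deriv ?_
    have h := hode _ hw
    have hs : Real.sin θ ^ 2 = 1 - Real.cos θ ^ 2 := Real.sin_sq θ
    simp only [Function.comp, Pi.mul_apply]
    rw [hs] at h ⊢
    generalize φ'' (z * Real.cos θ ^ 2 + (1 - Real.cos θ ^ 2)) = a at h ⊢
    generalize φ' (z * Real.cos θ ^ 2 + (1 - Real.cos θ ^ 2)) = b at h ⊢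
    generalize φ (z * Real.cos θ ^ 2 + (1 - Real.cos θ ^ 2)) = d at h ⊢
    linear_combination -h + (-2 * a * (1 - z) * Real.cos θ ^ 2 + b) * hs
  · exact (i2.sub i1).add i0

/-- The Mehler density `T_k(w) / √(1 + w)`. -/
noncomputable def mehler (k : ℤ) (w : ℝ) : ℝ :=
  chebT k w / √(1 + w)

/-- The derivative of the Mehler density. -/
noncomputable def mehler' (k : ℤ) (w : ℝ) : ℝ :=
  chebT' k w / √(1 + w) - chebT k w / (2 * √(1 + w) ^ 3)

/-- The second derivative of the Mehler density. -/
noncomputable def mehler'' (k : ℤ) (w : ℝ) : ℝ :=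
  (Polynomial.derivative (Polynomial.derivative (Polynomial.Chebyshev.T ℝ k))).eval w / √(1 + w) -
    chebT' k w / √(1 + w) ^ 3 + 3 * chebT k w / (4 * √(1 + w) ^ 5)

theorem hasDerivAt_sqrt_one_add {w : ℝ} (hw : -1 < w) :
    HasDerivAt (fun w => √(1 + w)) (1 / (2 * √(1 + w))) w :=
  ((hasDerivAt_id w).const_add 1).sqrt (by simp only [id]; linarith)

theorem hasDerivAt_mehler (k : ℤ) {w : ℝ} (hw : -1 < w) :
    HasDerivAt (mehler k) (mehler' k w) w := by
  have hs : 0 < √(1 + w) := Real.sqrt_pos.2 (by linarith)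
  refine (((Polynomial.Chebyshev.T ℝ k).hasDerivAt w).div (hasDerivAt_sqrt_one_add hw)
    hs.ne').congr_deriv ?_
  simp only [mehler', chebT, chebT']
  field_simp

theorem hasDerivAt_mehler' (k : ℤ) {w : ℝ} (hw : -1 < w) :
    HasDerivAt (mehler' k) (mehler'' k w) w := by
  have hs : 0 < √(1 + w) := Real.sqrt_pos.2 (by linarith)
  have h := hasDerivAt_sqrt_one_add hw
  refine (((Polynomial.derivative (Polynomial.Chebyshev.T ℝ k)).hasDerivAt w |>.div h hs.ne').sub
    (((Polynomial.Chebyshev.T ℝ k).hasDerivAt w).div ((h.pow 3).const_mul 2)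
      (mul_ne_zero two_ne_zero (pow_ne_zero 3 hs.ne')))).congr_deriv ?_
  simp only [mehler'', chebT, chebT', Pi.pow_apply]
  field_simp
  ring

theorem continuousOn_mehler'' (k : ℤ) : ContinuousOn (mehler'' k) (Ioi (-1)) := by
  have hs : ∀ w ∈ Ioi (-1 : ℝ), √(1 + w) ≠ 0 := fun w hw =>
    (Real.sqrt_pos.2 (by linarith [mem_Ioi.1 hw])).ne'
  have hc : ContinuousOn (fun w : ℝ => √(1 + w)) (Ioi (-1)) := by fun_prop
  unfold mehler'' chebT chebT'
  refine ((Polynomial.continuousOn _).div hc hs |>.sub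
    ((Polynomial.continuousOn _).div (hc.pow 3) fun w hw => pow_ne_zero _ (hs w hw))).add
    ((continuousOn_const.mul (Polynomial.continuousOn _)).div (continuousOn_const.mul (hc.pow 5))
      fun w hw => mul_ne_zero (by norm_num) (pow_ne_zero _ (hs w hw)))

theorem mehler_ode (k : ℤ) {w : ℝ} (hw : -1 < w) :
    (1 - w ^ 2) * mehler'' k w + (1 - 2 * w) * mehler' k w +
      ((k : ℝ) ^ 2 - 1 / 4) * mehler k w = 0 := by
  have hs : 0 < √(1 + w) := Real.sqrt_pos.2 (by linarith)
  have hsq : √(1 + w) ^ 2 = 1 + w := Real.sq_sqrt (by linarith)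
  have h := congrArg (Polynomial.eval w)
    (Polynomial.Chebyshev.one_sub_X_sq_mul_derivative_derivative_T_eq_poly_in_T (R := ℝ) k)
  simp only [mehler'', mehler', mehler, chebT, chebT']
  generalize √(1 + w) = s at hs hsq ⊢
  obtain rfl : w = s ^ 2 - 1 := by linarith
  simp at h
  generalize Polynomial.eval (s ^ 2 - 1) (Polynomial.Chebyshev.T ℝ k) = a at h ⊢
  generalize Polynomial.eval (s ^ 2 - 1)
    (Polynomial.derivative (Polynomial.Chebyshev.T ℝ k)) = b at h ⊢
  generalize Polynomial.eval (s ^ 2 - 1)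
    (Polynomial.derivative (Polynomial.derivative (Polynomial.Chebyshev.T ℝ k))) = d at h ⊢
  field_simp
  linear_combination 8 * s ^ 4 * h

/-- The elementary kernel `∫₀^{π/2} dθ / √(1 + z cos² θ + sin² θ)`. -/
noncomputable def baseKernel (z : ℝ) : ℝ := angularAvg (fun w => 1 / √(1 + w)) 0 z

theorem continuousOn_inv_sqrt_one_add : ContinuousOn (fun w : ℝ => 1 / √(1 + w)) (Ioi (-1)) := by
  refine continuousOn_const.div (by fun_prop) fun w hw => ?_
  exact (Real.sqrt_pos.2 (by linarith [mem_Ioi.1 hw])).ne'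

theorem baseKernel_nonneg (z : ℝ) : 0 ≤ baseKernel z := by
  refine intervalIntegral.integral_nonneg (by positivity) fun θ _ => ?_
  simp only [mul_zero, pow_zero]
  positivity

theorem angularAvg_le_angularAvg {φ ψ : ℝ → ℝ} {k l : ℕ} (hφ : ContinuousOn φ (Ioi (-1)))
    (hψ : ContinuousOn ψ (Ioi (-1))) {a z : ℝ} (ha : -1 < a) (haz : a ≤ z) (hz : z ≤ 1)
    (h : ∀ θ w : ℝ, a ≤ w → w ≤ 1 →
      Real.cos θ ^ (2 * k) * φ w ≤ Real.cos θ ^ (2 * l) * ψ w) :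
    angularAvg φ k z ≤ angularAvg ψ l z := by
  have hz' : -1 < z := ha.trans_le haz
  refine intervalIntegral.integral_mono_on (by positivity)
    ((continuous_angularIntegrand hφ k hz').intervalIntegrable _ _)
    ((continuous_angularIntegrand hψ l hz').intervalIntegrable _ _) fun θ _ => ?_
  have h1 := Real.sin_sq_add_cos_sq θ
  have hc := sq_nonneg (Real.cos θ)
  have hs := sq_nonneg (Real.sin θ)
  exact h θ _ (by nlinarith) (by nlinarith)

theorem angularAvg_const_mul (φ : ℝ → ℝ) (c : ℝ) (k : ℕ) (z : ℝ) :
    angularAvg (fun w => c * φ w) k z = c * angularAvg φ k z := by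
  unfold angularAvg
  rw [← intervalIntegral.integral_const_mul]
  congr 1 with θ
  ring

theorem angularAvg_mehler_one (k : ℤ) : angularAvg (mehler k) 0 1 = Real.pi / (2 * √2) := by
  have h : ∀ θ : ℝ, (1 : ℝ) * Real.cos θ ^ 2 + Real.sin θ ^ 2 = 1 := fun θ => by
    rw [one_mul, Real.cos_sq_add_sin_sq]
  simp only [angularAvg, h, mehler, chebT, Polynomial.Chebyshev.T_eval_one]
  norm_num
  field_simp

theorem half_baseKernel_le {k : ℤ} {a z : ℝ} (ha : -1 < a) (haz : a ≤ z) (hz : z ≤ 1)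
    (hT : ∀ w, a ≤ w → w ≤ 1 → 1 / 2 ≤ chebT k w) :
    1 / 2 * baseKernel z ≤ angularAvg (mehler k) 0 z := by
  rw [baseKernel, ← angularAvg_const_mul]
  refine angularAvg_le_angularAvg (continuousOn_const.mul continuousOn_inv_sqrt_one_add)
    (fun w hw => (hasDerivAt_mehler k hw).continuousAt.continuousWithinAt) ha haz hz
    fun θ w h1 h2 => ?_
  simp only [mul_zero, pow_zero, one_mul, mehler, Pi.mul_apply]
  rw [mul_one_div]
  gcongr
  exact hT w h1 h2

theorem angularAvg_mehler'_le {k : ℤ} {a z B : ℝ} (ha : -1 < a) (haz : a ≤ z) (hz : z ≤ 1)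
    (hB : 0 ≤ B) (hT : ∀ w, a ≤ w → w ≤ 1 → 0 ≤ chebT k w)
    (hT' : ∀ w, a ≤ w → w ≤ 1 → chebT' k w ≤ B) :
    angularAvg (mehler' k) 1 z ≤ B * baseKernel z := by
  rw [baseKernel, ← angularAvg_const_mul]
  refine angularAvg_le_angularAvg
    (fun w hw => (hasDerivAt_mehler' k hw).continuousAt.continuousWithinAt)
    (continuousOn_const.mul continuousOn_inv_sqrt_one_add) ha haz hz fun θ w h1 h2 => ?_
  simp only [mul_zero, pow_zero, one_mul, mul_one, Pi.mul_apply]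
  have hle : mehler' k w ≤ B * (1 / √(1 + w)) := by
    have h3 : 0 ≤ chebT k w / (2 * √(1 + w) ^ 3) := div_nonneg (hT w h1 h2) (by positivity)
    have h4 : chebT' k w / √(1 + w) ≤ B / √(1 + w) := by gcongr; exact hT' w h1 h2
    rw [mul_one_div]
    unfold mehler'
    linarith
  have hc := Real.cos_sq_le_one θ
  have hR : 0 ≤ B * (1 / √(1 + w)) := by positivity
  nlinarith [sq_nonneg (Real.cos θ)]

/-- The argument of the Riemann function of the radial wave operator. -/
noncomputable def coneArg (r t lam : ℝ) : ℝ := (r ^ 2 + lam ^ 2 - t ^ 2) / (2 * r * lam)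

theorem coneArg_pos {r t lam : ℝ} (ht : 0 ≤ t) (htr : t < r) (hlam : 0 < lam) :
    0 < coneArg r t lam := by
  have : 0 < r := ht.trans_lt htr
  exact div_pos (by nlinarith [sq_pos_of_pos hlam]) (by positivity)

/-- The substitution `ρ² = (λ - r)² + (t² - (λ - r)²) cos² θ` reduces the elliptic integral over
`ρ` to the elementary kernel. -/
theorem lintegral_radial_le {r t lam : ℝ} (ht : 0 < t) (htr : t < r) (hlam : |lam - r| < t) :
    ∫⁻ ρ in Ioo |lam - r| t, ENNReal.ofReal (ρ / √(t ^ 2 - ρ ^ 2) /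
      (√(lam ^ 2 - (r - ρ) ^ 2) * √((r + ρ) ^ 2 - lam ^ 2))) ≤
    ENNReal.ofReal (baseKernel (coneArg r t lam) / √(2 * lam * r)) := by
  set z := coneArg r t lam with hz
  set a := |lam - r| with ha
  have ha0 : 0 ≤ a := abs_nonneg _
  have hr : 0 < r := ht.trans htr
  obtain ⟨hl1, hl2⟩ := abs_lt.1 hlam
  have hl0 : 0 < lam := by linarith
  have hasq : a ^ 2 = (lam - r) ^ 2 := sq_abs _
  have hD : 0 < t ^ 2 - a ^ 2 := by nlinarith
  have hX : 0 < 2 * lam * r := by positivity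
  have hz1 : -1 < z := by linarith [coneArg_pos ht.le htr hl0]
  have hXz : 2 * lam * r * z = r ^ 2 + lam ^ 2 - t ^ 2 := by
    rw [hz, coneArg]; field_simp
  set D := t ^ 2 - a ^ 2 with hDdef
  set P : ℝ → ℝ := fun θ => √(a ^ 2 + D * Real.cos θ ^ 2) with hP
  have hcos : ∀ θ ∈ Ioo 0 (Real.pi / 2), 0 < Real.cos θ := fun θ hθ =>
    Real.cos_pos_of_mem_Ioo ⟨by linarith [hθ.1, Real.pi_pos], hθ.2⟩
  have hsin : ∀ θ ∈ Ioo 0 (Real.pi / 2), 0 < Real.sin θ := fun θ hθ =>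
    Real.sin_pos_of_pos_of_lt_pi hθ.1 (by linarith [hθ.2, Real.pi_pos])
  have hsub : Ioo a t ⊆ P '' Ioo 0 (Real.pi / 2) := by
    have h := intermediate_value_Ioo' (f := P) (by positivity : (0 : ℝ) ≤ Real.pi / 2)
      (by simp only [hP]; fun_prop)
    have h0 : P 0 = t := by
      simp only [hP, Real.cos_zero, hDdef]
      rw [show a ^ 2 + (t ^ 2 - a ^ 2) * 1 ^ 2 = t ^ 2 by ring, Real.sqrt_sq ht.le]
    have h1 : P (Real.pi / 2) = a := by
      simp only [hP, Real.cos_pi_div_two]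
      rw [show a ^ 2 + D * 0 ^ 2 = a ^ 2 by ring, Real.sqrt_sq ha0]
    rwa [h0, h1] at h
  have hinj : InjOn P (Ioo 0 (Real.pi / 2)) := by
    intro x hx y hy hxy
    have hx0 := hcos x hx
    have hy0 := hcos y hy
    simp only [hP] at hxy
    rw [Real.sqrt_inj (by positivity) (by positivity)] at hxy
    have hsq : Real.cos x ^ 2 = Real.cos y ^ 2 := by
      have : D * Real.cos x ^ 2 = D * Real.cos y ^ 2 := by linarith
      exact mul_left_cancel₀ hD.ne' this
    have hc : Real.cos x = Real.cos y := by
      rwa [sq_eq_sq₀ hx0.le hy0.le] at hsq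
    exact Real.injOn_cos ⟨hx.1.le, by linarith [hx.2, Real.pi_pos]⟩
      ⟨hy.1.le, by linarith [hy.2, Real.pi_pos]⟩ hc
  have hderiv : ∀ θ ∈ Ioo 0 (Real.pi / 2), HasDerivWithinAt P
      (-(D * Real.cos θ * Real.sin θ) / P θ) (Ioo 0 (Real.pi / 2)) θ := by
    intro θ hθ
    have hc := hcos θ hθ
    have h1 : a ^ 2 + D * Real.cos θ ^ 2 ≠ 0 := by positivity
    refine ((((((Real.hasDerivAt_cos θ).pow 2).const_mul D).const_add (a ^ 2)).sqrt
      h1).congr_deriv ?_).hasDerivWithinAt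
    simp only [hP, Pi.pow_apply]
    have : √(a ^ 2 + D * Real.cos θ ^ 2) ≠ 0 := by positivity
    field_simp
    simp
    ring
  refine (lintegral_mono_set hsub).trans ?_
  rw [lintegral_image_eq_lintegral_abs_deriv_mul measurableSet_Ioo hderiv hinj]
  have hcont := continuous_angularIntegrand continuousOn_inv_sqrt_one_add 0 hz1
  have hval : baseKernel z / √(2 * lam * r) = ∫ θ in Ioo 0 (Real.pi / 2),
      Real.cos θ ^ (2 * 0) * (1 / √(1 + (z * Real.cos θ ^ 2 + Real.sin θ ^ 2))) /
        √(2 * lam * r) := by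
    rw [integral_div, ← integral_Ioc_eq_integral_Ioo,
      ← intervalIntegral.integral_of_le (by positivity)]
    rfl
  rw [hval, ofReal_integral_eq_lintegral_ofReal
    ((hcont.div_const _).integrableOn_Icc.mono_set Ioo_subset_Icc_self)]
  · refine le_of_eq (setLIntegral_congr_fun measurableSet_Ioo fun θ hθ => ?_)
    have hc := hcos θ hθ
    have hs := hsin θ hθ
    have hcs := Real.sin_sq_add_cos_sq θ
    rw [← ENNReal.ofReal_mul (abs_nonneg _)]
    congr 1
    have hp : 0 < P θ := by simp only [hP]; positivity
    have hpsq : P θ ^ 2 = a ^ 2 + D * Real.cos θ ^ 2 := Real.sq_sqrt (by positivity)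
    have hY : 0 < 1 + (z * Real.cos θ ^ 2 + Real.sin θ ^ 2) := by
      linarith [neg_one_lt_mix hz1 θ]
    have hap : a ≤ P θ :=
      Real.le_sqrt_of_sq_le (by nlinarith [mul_pos hD (pow_pos hc 2)])
    have hpt : P θ ≤ t := by
      refine (Real.sqrt_le_left ht.le).2 ?_
      nlinarith [mul_pos hD (pow_pos hs 2)]
    have habs := abs_le.1 hap
    have e1 : √(t ^ 2 - P θ ^ 2) = √D * Real.sin θ := by
      rw [hpsq, show t ^ 2 - (a ^ 2 + D * Real.cos θ ^ 2) = D * Real.sin θ ^ 2 by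
        rw [hDdef]; linear_combination (t ^ 2 - a ^ 2) * (-hcs), Real.sqrt_mul hD.le,
        Real.sqrt_sq hs.le]
    have e2 : √(lam ^ 2 - (r - P θ) ^ 2) * √((r + P θ) ^ 2 - lam ^ 2) =
        √(2 * lam * r) * √(1 + (z * Real.cos θ ^ 2 + Real.sin θ ^ 2)) *
          (√D * Real.cos θ) := by
      have hDc : √D * Real.cos θ = √(D * Real.cos θ ^ 2) := by
        rw [Real.sqrt_mul hD.le, Real.sqrt_sq hc.le]
      rw [hDc, ← Real.sqrt_mul (by nlinarith), ← Real.sqrt_mul hX.le,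
        ← Real.sqrt_mul (mul_pos hX hY).le]
      congr 1
      have h3 : 2 * lam * r * (1 + (z * Real.cos θ ^ 2 + Real.sin θ ^ 2)) =
          4 * lam * r - D * Real.cos θ ^ 2 := by
        rw [hDdef, hasq]
        linear_combination Real.cos θ ^ 2 * hXz + 2 * lam * r * hcs
      rw [h3, show D * Real.cos θ ^ 2 = P θ ^ 2 - (lam - r) ^ 2 by rw [hpsq, hasq]; ring]
      ring
    rw [e1, e2, abs_div, abs_neg, abs_of_pos (by positivity : 0 < D * Real.cos θ * Real.sin θ),
      abs_of_pos hp]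
    have hDs : √D * √D = D := Real.mul_self_sqrt hD.le
    have hDp : 0 < √D := Real.sqrt_pos.2 hD
    have hXp : 0 < √(2 * lam * r) := Real.sqrt_pos.2 hX
    have hYp : 0 < √(1 + (z * Real.cos θ ^ 2 + Real.sin θ ^ 2)) := Real.sqrt_pos.2 hY
    generalize √(1 + (z * Real.cos θ ^ 2 + Real.sin θ ^ 2)) = y at hYp ⊢
    generalize √(2 * lam * r) = x at hXp ⊢
    generalize √D = d at hDs hDp ⊢
    rw [← hDs]
    field_simp
    simp
  · refine .of_forall fun θ => ?_
    simp only [mul_zero, pow_zero]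
    positivity

theorem continuousOn_baseKernel : ContinuousOn baseKernel (Ioi (-1)) := by
  have h : baseKernel = angularAvg (mehler 0) 0 := by
    funext z; simp [baseKernel, angularAvg, mehler, chebT]
  rw [h]
  exact fun z hz => (hasDerivAt_angularAvg (fun w hw => hasDerivAt_mehler 0 hw)
    (fun w hw => (hasDerivAt_mehler' 0 hw).continuousAt.continuousWithinAt) 0
    hz).continuousAt.continuousWithinAt

theorem continuousOn_coneArg (r t : ℝ) (hr : 0 < r) : ContinuousOn (coneArg r t) (Ioi 0) := by
  unfold coneArg
  exact ContinuousOn.div (by fun_prop) (by fun_prop) fun x hx =>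
    (mul_pos (by positivity) (mem_Ioi.1 hx)).ne'

/-- Exchanging the order of integration in the double integral over the cone section. -/
theorem iterated_integral_le {r t : ℝ} (ht : 0 < t) (htr : t < r) {Γ : ℝ → ℝ}
    (hΓ : ContinuousOn Γ (Icc (r - t) (r + t))) (hΓ0 : ∀ x ∈ Icc (r - t) (r + t), 0 ≤ Γ x) :
    ∫ ρ in (0 : ℝ)..t, (ρ / √(t ^ 2 - ρ ^ 2)) * ∫ lam in (r - ρ)..(r + ρ),
      Γ lam / (√(lam ^ 2 - (r - ρ) ^ 2) * √((r + ρ) ^ 2 - lam ^ 2)) ≤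
    ∫ lam in (r - t)..(r + t), Γ lam * (baseKernel (coneArg r t lam) / √(2 * lam * r)) := by
  have hr : 0 < r := ht.trans htr
  have hle : r - t ≤ r + t := by linarith
  set Γ' : ℝ → ℝ := IccExtend hle (domRestrict _ Γ) with hΓ'
  have hΓ'c : Continuous Γ' := (continuousOn_iff_continuous_domRestrict.1 hΓ).Icc_extend'
  have hΓ'eq : ∀ x ∈ Icc (r - t) (r + t), Γ' x = Γ x := fun x hx =>
    IccExtend_of_mem hle (domRestrict _ Γ) hx
  set q : ℝ → ℝ → ℝ := fun ρ lam => ρ / √(t ^ 2 - ρ ^ 2) /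
      (√(lam ^ 2 - (r - ρ) ^ 2) * √((r + ρ) ^ 2 - lam ^ 2)) with hq
  set S : Set (ℝ × ℝ) := {p | |p.2 - r| < p.1} ∩ {p | p.1 < t} with hS
  set k : ℝ → ℝ → ENNReal := fun ρ lam =>
    S.indicator (fun p => ENNReal.ofReal (Γ' p.2) * ENNReal.ofReal (q p.1 p.2)) (ρ, lam) with hk
  have hSm : MeasurableSet S :=
    (measurableSet_lt (by fun_prop) (by fun_prop)).inter
      (measurableSet_lt (by fun_prop) (by fun_prop))
  have hmemS : ∀ ρ lam, (ρ, lam) ∈ S ↔ |lam - r| < ρ ∧ ρ < t := fun ρ lam => Iff.rfl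
  have hkm : Measurable (Function.uncurry k) := by
    have : Function.uncurry k = S.indicator
        (fun p => ENNReal.ofReal (Γ' p.2) * ENNReal.ofReal (q p.1 p.2)) := by
      ext ⟨a, b⟩; rfl
    rw [this]
    refine Measurable.indicator ?_ hSm
    have := hΓ'c.measurable
    simp only [hq]
    fun_prop
  have hgc : ContinuousOn
      (fun lam => Γ lam * (baseKernel (coneArg r t lam) / √(2 * lam * r)))
      (Icc (r - t) (r + t)) := by
    have hpos : ∀ x ∈ Icc (r - t) (r + t), 0 < x := fun x hx => by linarith [hx.1]
    refine hΓ.mul (ContinuousOn.div ?_ (by fun_prop) fun x hx => ?_)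
    · refine continuousOn_baseKernel.comp ((continuousOn_coneArg r t hr).mono hpos) fun x hx => ?_
      simpa using (by linarith [coneArg_pos ht.le htr (hpos x hx)] : -1 < coneArg r t x)
    · have := hpos x hx
      positivity
  have hg0 : ∀ x ∈ Icc (r - t) (r + t),
      0 ≤ Γ x * (baseKernel (coneArg r t x) / √(2 * x * r)) := fun x hx =>
    mul_nonneg (hΓ0 x hx) (div_nonneg (baseKernel_nonneg _) (Real.sqrt_nonneg _))
  have hright : ENNReal.ofReal (∫ lam in (r - t)..(r + t),
      Γ lam * (baseKernel (coneArg r t lam) / √(2 * lam * r))) =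
      ∫⁻ lam in Ioo (r - t) (r + t),
        ENNReal.ofReal (Γ lam * (baseKernel (coneArg r t lam) / √(2 * lam * r))) := by
    rw [intervalIntegral.integral_of_le hle, integral_Ioc_eq_integral_Ioo,
      ofReal_integral_eq_lintegral_ofReal (hgc.integrableOn_Icc.mono_set Ioo_subset_Icc_self)]
    exact (ae_restrict_iff' measurableSet_Ioo).2
      (.of_forall fun x hx => hg0 x (Ioo_subset_Icc_self hx))
  have hinner : ∀ lam, ∫⁻ ρ, k ρ lam ≤ (Ioo (r - t) (r + t)).indicator (fun lam =>
      ENNReal.ofReal (Γ lam * (baseKernel (coneArg r t lam) / √(2 * lam * r)))) lam := by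
    intro lam
    by_cases hl : lam ∈ Ioo (r - t) (r + t)
    · have hl' : |lam - r| < t := abs_lt.2 ⟨by linarith [hl.1], by linarith [hl.2]⟩
      have hlc := Ioo_subset_Icc_self hl
      rw [indicator_of_mem hl, ENNReal.ofReal_mul (hΓ0 _ hlc)]
      calc ∫⁻ ρ, k ρ lam
          = ∫⁻ ρ, (Ioo |lam - r| t).indicator
              (fun ρ => ENNReal.ofReal (Γ lam) * ENNReal.ofReal (q ρ lam)) ρ := by
            refine lintegral_congr fun ρ => ?_
            simp only [hk, indicator, hS, mem_inter_iff, mem_ofPred_eq, mem_Ioo, hΓ'eq _ hlc]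
        _ = ENNReal.ofReal (Γ lam) * ∫⁻ ρ in Ioo |lam - r| t, ENNReal.ofReal (q ρ lam) := by
            rw [lintegral_indicator measurableSet_Ioo,
              lintegral_const_mul' _ _ ENNReal.ofReal_ne_top]
        _ ≤ _ := by gcongr; exact lintegral_radial_le ht htr hl'
    · have h0 : ∀ ρ, k ρ lam = 0 := by
        intro ρ
        refine indicator_of_notMem (fun hmem => hl ?_) _
        rw [hmemS] at hmem
        obtain ⟨h1, h2⟩ := abs_lt.1 (hmem.1.trans hmem.2)
        exact ⟨by linarith, by linarith⟩
      simp [h0]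
  have hleft : ENNReal.ofReal (∫ ρ in (0 : ℝ)..t, (ρ / √(t ^ 2 - ρ ^ 2)) *
      ∫ lam in (r - ρ)..(r + ρ),
        Γ lam / (√(lam ^ 2 - (r - ρ) ^ 2) * √((r + ρ) ^ 2 - lam ^ 2))) ≤
      ∫⁻ ρ, ∫⁻ lam, k ρ lam := by
    refine (Real.ofReal_le_enorm _).trans ?_
    rw [intervalIntegral.integral_of_le ht.le, integral_Ioc_eq_integral_Ioo]
    refine (enorm_integral_le_lintegral_enorm _).trans ?_
    refine le_trans (setLIntegral_mono' measurableSet_Ioo fun ρ hρ => ?_)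
      (setLIntegral_le_lintegral (Ioo 0 t) _)
    have hρ0 : 0 < ρ := hρ.1
    rw [intervalIntegral.integral_of_le (by linarith), integral_Ioc_eq_integral_Ioo, enorm_mul]
    refine (mul_le_mul_right (enorm_integral_le_lintegral_enorm _) _).trans ?_
    rw [← lintegral_const_mul' _ _ enorm_ne_top, ← lintegral_indicator measurableSet_Ioo]
    refine lintegral_mono fun lam => ?_
    rw [indicator_apply]
    split_ifs with hl
    · have hlt := hρ.2
      have hlS : (ρ, lam) ∈ S :=
        (hmemS ρ lam).2 ⟨abs_lt.2 ⟨by linarith [hl.1], by linarith [hl.2]⟩, hρ.2⟩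
      have hlc : lam ∈ Icc (r - t) (r + t) := ⟨by linarith [hl.1], by linarith [hl.2]⟩
      have hΓl := hΓ0 lam hlc
      simp only [hk]
      rw [indicator_of_mem hlS, hΓ'eq _ hlc, ← ENNReal.ofReal_mul hΓl, ← enorm_mul,
        Real.enorm_of_nonneg (by positivity)]
      refine le_of_eq (congrArg _ ?_)
      simp only [hq]
      ring
    · exact zero_le
  have hfinal := hleft.trans ((lintegral_lintegral_swap hkm.aemeasurable).le.trans
    (lintegral_mono hinner))
  rw [lintegral_indicator measurableSet_Ioo, ← hright] at hfinal
  exact (ENNReal.ofReal_le_ofReal_iff (intervalIntegral.integral_nonneg hle hg0)).1 hfinal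

/-- Green's identity `∮ (F dλ + Q dτ) = 0` on a characteristic triangle, for `F_τ = Q_λ`. -/
theorem integral_base_characteristic_triangle {F Q : ℝ × ℝ → ℝ} {r t : ℝ} (ht : 0 < t)
    (hFc : ContinuousOn F {p | 0 ≤ p.2 ∧ |p.1 - r| ≤ t - p.2})
    (hQc : ContinuousOn Q {p | 0 ≤ p.2 ∧ |p.1 - r| ≤ t - p.2})
    (hF : ∀ x τ, 0 < τ → |x - r| < t - τ → DifferentiableAt ℝ F (x, τ))
    (hQ : ∀ x τ, 0 < τ → |x - r| < t - τ → DifferentiableAt ℝ Q (x, τ))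
    (hFQ : ∀ x τ, 0 < τ → |x - r| < t - τ →
      fderiv ℝ F (x, τ) (0, 1) = fderiv ℝ Q (x, τ) (1, 0)) :
    ∫ x in (r - t)..(r + t), F (x, 0) =
      (∫ τ in (0 : ℝ)..t, (F (r + (t - τ), τ) - Q (r + (t - τ), τ))) +
        ∫ τ in (0 : ℝ)..t, (F (r - (t - τ), τ) + Q (r - (t - τ), τ)) := by
  set Φ : ℝ × ℝ → ℝ × ℝ := fun p => (r + p.1 * (t - p.2), p.2) with hΦ
  set L : ℝ × ℝ → ℝ × ℝ →L[ℝ] ℝ × ℝ := fun p =>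
    ((p.1 • -ContinuousLinearMap.snd ℝ ℝ ℝ + (t - p.2) • ContinuousLinearMap.fst ℝ ℝ ℝ).prod
      (ContinuousLinearMap.snd ℝ ℝ ℝ)) with hL
  have hΦd : ∀ p, HasFDerivAt Φ (L p) p := fun p =>
    ((hasFDerivAt_fst.mul (hasFDerivAt_snd.const_sub t)).const_add r).prodMk hasFDerivAt_snd
  have hΦc : Continuous Φ := by fun_prop
  have hmaps : MapsTo Φ (uIcc (-1) 1 ×ˢ uIcc 0 t) {p | 0 ≤ p.2 ∧ |p.1 - r| ≤ t - p.2} := by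
    rintro ⟨s, τ⟩ ⟨hs, hτ⟩
    rw [uIcc_of_le (by norm_num)] at hs
    rw [uIcc_of_le ht.le] at hτ
    have hτ2 : 0 ≤ t - τ := by linarith [hτ.2]
    refine ⟨hτ.1, ?_⟩
    simp only [hΦ, add_sub_cancel_left, abs_mul, abs_of_nonneg hτ2]
    exact mul_le_of_le_one_left hτ2 (abs_le.2 hs)
  have hdom : ∀ x ∈ Ioo (min (-1 : ℝ) 1) (max (-1) 1) ×ˢ Ioo (min 0 t) (max 0 t),
      0 < x.2 ∧ |(Φ x).1 - r| < t - x.2 := by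
    rintro ⟨s, τ⟩ ⟨hs, hτ⟩
    rw [min_eq_left (by norm_num), max_eq_right (by norm_num)] at hs
    rw [min_eq_left ht.le, max_eq_right ht.le] at hτ
    have hτ2 : 0 < t - τ := by linarith [hτ.2]
    refine ⟨hτ.1, ?_⟩
    simp only [hΦ, add_sub_cancel_left, abs_mul, abs_of_pos hτ2]
    exact mul_lt_of_lt_one_left hτ2 (abs_lt.2 hs)
  set X' : ℝ × ℝ → ℝ × ℝ →L[ℝ] ℝ := fun p =>
    (p.1 • (fderiv ℝ F (Φ p)).comp (L p) + F (Φ p) • ContinuousLinearMap.fst ℝ ℝ ℝ) -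
      (fderiv ℝ Q (Φ p)).comp (L p) with hX'
  set Y' : ℝ × ℝ → ℝ × ℝ →L[ℝ] ℝ := fun p =>
    (t - p.2) • (fderiv ℝ F (Φ p)).comp (L p) + F (Φ p) • -ContinuousLinearMap.snd ℝ ℝ ℝ with hY'
  have hdiv : ∀ x ∈ Ioo (min (-1 : ℝ) 1) (max (-1) 1) ×ˢ Ioo (min 0 t) (max 0 t),
      X' x (1, 0) + Y' x (0, 1) = 0 := by
    intro x hx
    obtain ⟨h1, h2⟩ := hdom x hx
    have h := hFQ _ _ h1 h2
    have e1 : L x (1, 0) = (t - x.2) • ((1, 0) : ℝ × ℝ) := by simp [hL]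
    have e2 : L x (0, 1) = (-x.1) • ((1, 0) : ℝ × ℝ) + ((0, 1) : ℝ × ℝ) := by simp [hL]
    have e3 : Φ x = ((Φ x).1, x.2) := rfl
    rw [← e3] at h
    simp only [hX', hY', add_apply, sub_apply,
      smul_apply, ContinuousLinearMap.comp_apply, e1, e2, map_add, map_smul,
      ContinuousLinearMap.coe_fst', ContinuousLinearMap.coe_snd', neg_apply,
      smul_eq_mul, h]
    ring
  have hae : ∀ᵐ x ∂(volume.restrict (uIcc (-1 : ℝ) 1 ×ˢ uIcc 0 t)),
      X' x (1, 0) + Y' x (0, 1) = 0 := by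
    have hnull : (uIcc (-1 : ℝ) 1 ×ˢ uIcc 0 t : Set (ℝ × ℝ)) =ᵐ[volume]
        (Ioo (min (-1 : ℝ) 1) (max (-1) 1) ×ˢ Ioo (min 0 t) (max 0 t) : Set (ℝ × ℝ)) := by
      rw [Measure.volume_eq_prod]
      exact Measure.set_prod_ae_eq Ioo_ae_eq_Icc.symm Ioo_ae_eq_Icc.symm
    rw [Measure.restrict_congr_set hnull]
    exact (ae_restrict_iff' (measurableSet_Ioo.prod measurableSet_Ioo)).2 (.of_forall hdiv)
  have hgreen := integral2_divergence_prod_of_hasFDerivAt_off_countable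
    (fun p => p.1 * F (Φ p) - Q (Φ p)) (fun p => (t - p.2) * F (Φ p)) X' Y' (-1) 0 1 t ∅
    countable_empty
    ((continuousOn_fst.mul (hFc.comp hΦc.continuousOn hmaps)).sub
      (hQc.comp hΦc.continuousOn hmaps))
    ((continuousOn_const.sub continuousOn_snd).mul (hFc.comp hΦc.continuousOn hmaps))
    (fun x hx => by
      obtain ⟨h1, h2⟩ := hdom x hx.1
      exact (hasFDerivAt_fst.mul ((hF _ _ h1 h2).hasFDerivAt.comp x (hΦd x))).sub
        ((hQ _ _ h1 h2).hasFDerivAt.comp x (hΦd x)))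
    (fun x hx => by
      obtain ⟨h1, h2⟩ := hdom x hx.1
      exact (hasFDerivAt_snd.const_sub t).mul ((hF _ _ h1 h2).hasFDerivAt.comp x (hΦd x)))
    ((integrable_zero _ _ _).congr (hae.mono fun x hx => hx.symm))
  have hzero : (∫ x in (-1 : ℝ)..1, ∫ y in (0 : ℝ)..t, X' (x, y) (1, 0) + Y' (x, y) (0, 1)) = 0 := by
    rw [intervalIntegral.integral_of_le (by norm_num), integral_Ioc_eq_integral_Ioo]
    refine integral_eq_zero_of_ae ((ae_restrict_iff' measurableSet_Ioo).2 (.of_forall fun x hx => ?_))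
    simp only [Pi.zero_apply]
    rw [intervalIntegral.integral_of_le ht.le, integral_Ioc_eq_integral_Ioo]
    refine integral_eq_zero_of_ae ((ae_restrict_iff' measurableSet_Ioo).2 (.of_forall fun y hy => ?_))
    refine hdiv (x, y) ⟨?_, ?_⟩
    · simpa using hx
    · simpa [ht.le] using hy
  rw [hzero] at hgreen
  simp only [hΦ, sub_self, sub_zero, zero_mul, one_mul, neg_one_mul, mul_zero, add_zero,
    intervalIntegral.integral_zero, ← sub_eq_add_neg] at hgreen
  have hbase : ∫ x in (-1 : ℝ)..1, t * F (r + x * t, 0) = ∫ x in (r - t)..(r + t), F (x, 0) := by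
    rw [intervalIntegral.integral_const_mul]
    have := intervalIntegral.mul_integral_comp_add_mul (f := fun x => F (x, 0)) (a := -1)
      (b := 1) t r
    simpa only [mul_comm _ t, mul_neg, mul_one, ← sub_eq_add_neg] using this
  rw [hbase] at hgreen
  have hneg : ∫ τ in (0 : ℝ)..t, (F (r - (t - τ), τ) + Q (r - (t - τ), τ)) =
      -∫ τ in (0 : ℝ)..t, (-F (r - (t - τ), τ) - Q (r - (t - τ), τ)) := by
    rw [← intervalIntegral.integral_neg]
    congr 1 with τ
    ring
  rw [hneg]
  linarith

theorem hasDerivAt_coneArg_time {r lam : ℝ} (hr : 0 < r) (hlam : 0 < lam) (t τ : ℝ) :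
    HasDerivAt (fun τ => coneArg r (t - τ) lam) ((t - τ) / (r * lam)) τ := by
  unfold coneArg
  refine (((((hasDerivAt_id τ).const_sub t).pow 2).const_sub (r ^ 2 + lam ^ 2)).div_const
    (2 * r * lam)).congr_deriv ?_
  simp
  field_simp

theorem hasDerivAt_coneArg_space {r lam : ℝ} (hr : 0 < r) (hlam : 0 < lam) (s : ℝ) :
    HasDerivAt (coneArg r s) ((lam ^ 2 - r ^ 2 + s ^ 2) / (2 * r * lam ^ 2)) lam := by
  unfold coneArg
  refine (((((hasDerivAt_id lam).pow 2).const_add (r ^ 2)).sub_const (s ^ 2)).div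
    ((hasDerivAt_id lam).const_mul (2 * r)) (by simp; constructor <;> positivity)).congr_deriv ?_
  simp
  field_simp
  ring

theorem fderiv_apply_time {F : ℝ × ℝ → ℝ} {x τ d : ℝ} (hF : DifferentiableAt ℝ F (x, τ))
    (h : HasDerivAt (fun s => F (x, s)) d τ) : fderiv ℝ F (x, τ) (0, 1) = d :=
  (hF.hasFDerivAt.comp_hasDerivAt τ
    ((hasDerivAt_const τ x).prodMk (hasDerivAt_id τ))).unique h

theorem fderiv_apply_space {F : ℝ × ℝ → ℝ} {x τ d : ℝ} (hF : DifferentiableAt ℝ F (x, τ))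
    (h : HasDerivAt (fun s => F (s, τ)) d x) : fderiv ℝ F (x, τ) (1, 0) = d :=
  (hF.hasFDerivAt.comp_hasDerivAt x
    ((hasDerivAt_id x).prodMk (hasDerivAt_const x τ))).unique h

theorem hasDerivAt_slice_time {F : ℝ × ℝ → ℝ} {x τ : ℝ} (hF : DifferentiableAt ℝ F (x, τ)) :
    HasDerivAt (fun s => F (x, s)) (fderiv ℝ F (x, τ) (0, 1)) τ :=
  hF.hasFDerivAt.comp_hasDerivAt τ ((hasDerivAt_const τ x).prodMk (hasDerivAt_id τ))

theorem hasDerivAt_slice_space {F : ℝ × ℝ → ℝ} {x τ : ℝ} (hF : DifferentiableAt ℝ F (x, τ)) :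
    HasDerivAt (fun s => F (s, τ)) (fderiv ℝ F (x, τ) (1, 0)) x :=
  hF.hasFDerivAt.comp_hasDerivAt x ((hasDerivAt_id x).prodMk (hasDerivAt_const x τ))

/-- Riemann's representation formula for `w_ττ - w_λλ + (c / λ²) w = 0`, where the Riemann function
is `K` composed with `coneArg`, and `K` solves Legendre's equation. Here `p` and `q` are the
partial derivatives `w_λ` and `w_τ`, extended continuously to the initial line. -/
theorem riemann_representation {K K' K'' : ℝ → ℝ} {c : ℝ}
    (hK : ∀ z, -1 < z → HasDerivAt K (K' z) z) (hK' : ∀ z, -1 < z → HasDerivAt K' (K'' z) z)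
    (hK1 : K 1 = 1)
    (hode : ∀ z, -1 < z → (1 - z ^ 2) * K'' z - 2 * z * K' z + c * K z = 0)
    {w p q : ℝ × ℝ → ℝ} (hw : ContinuousOn w (Ioi 0 ×ˢ Ici 0))
    (hp : ContinuousOn p (Ioi 0 ×ˢ Ici 0)) (hq : ContinuousOn q (Ioi 0 ×ˢ Ici 0))
    (hwd : ∀ x τ, 0 < x → 0 < τ → DifferentiableAt ℝ w (x, τ) ∧
      fderiv ℝ w (x, τ) (1, 0) = p (x, τ) ∧ fderiv ℝ w (x, τ) (0, 1) = q (x, τ))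
    (hpd : ∀ x τ, 0 < x → 0 < τ → DifferentiableAt ℝ p (x, τ))
    (hqd : ∀ x τ, 0 < x → 0 < τ → DifferentiableAt ℝ q (x, τ))
    (hpde : ∀ x τ, 0 < x → 0 < τ →
      fderiv ℝ q (x, τ) (0, 1) - fderiv ℝ p (x, τ) (1, 0) + c / x ^ 2 * w (x, τ) = 0)
    {r t : ℝ} (ht : 0 < t) (htr : t < r) :
    2 * w (r, t) = w (r + t, 0) + w (r - t, 0) +
      ∫ x in (r - t)..(r + t), (K (coneArg r t x) * q (x, 0) -
        w (x, 0) * (K' (coneArg r t x) * (t / (r * x)))) := by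
  have hr : 0 < r := ht.trans htr
  set Z : ℝ × ℝ → ℝ := fun y => coneArg r (t - y.2) y.1 with hZ
  set F : ℝ × ℝ → ℝ := fun y =>
    K (Z y) * q y - w y * (K' (Z y) * ((t - y.2) / (r * y.1))) with hF
  set Q : ℝ × ℝ → ℝ := fun y => K (Z y) * p y -
    w y * (K' (Z y) * ((y.1 ^ 2 - r ^ 2 + (t - y.2) ^ 2) / (2 * r * y.1 ^ 2))) with hQ
  set Δ : Set (ℝ × ℝ) := {y | 0 ≤ y.2 ∧ |y.1 - r| ≤ t - y.2} with hΔ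
  have hΔ1 : ∀ y ∈ Δ, 0 < y.1 ∧ 0 ≤ y.2 ∧ 0 ≤ t - y.2 := by
    rintro y ⟨h1, h2⟩
    have h3 := abs_le.1 h2
    exact ⟨by linarith, h1, (abs_nonneg _).trans h2⟩
  have hΔD : Δ ⊆ Ioi 0 ×ˢ Ici 0 := fun y hy => ⟨(hΔ1 y hy).1, (hΔ1 y hy).2.1⟩
  have hZpos : ∀ y ∈ Δ, -1 < Z y := fun y hy => by
    obtain ⟨h1, h2, h3⟩ := hΔ1 y hy
    linarith [coneArg_pos h3 (by linarith : t - y.2 < r) h1]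
  have hZc : ContinuousOn Z Δ := by
    simp only [hZ, coneArg]
    refine ContinuousOn.div (by fun_prop) (by fun_prop) fun y hy => ?_
    have := (hΔ1 y hy).1
    positivity
  have hKc : ContinuousOn (fun y => K (Z y)) Δ := fun y hy =>
    (hK _ (hZpos y hy)).continuousAt.comp_continuousWithinAt (hZc y hy)
  have hKc' : ContinuousOn (fun y => K' (Z y)) Δ := fun y hy =>
    (hK' _ (hZpos y hy)).continuousAt.comp_continuousWithinAt (hZc y hy)
  have hFc : ContinuousOn F Δ := by
    refine (hKc.mul (hq.mono hΔD)).sub ((hw.mono hΔD).mul (hKc'.mul ?_))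
    refine ContinuousOn.div (by fun_prop) (by fun_prop) fun y hy => ?_
    have := (hΔ1 y hy).1
    positivity
  have hQc : ContinuousOn Q Δ := by
    refine (hKc.mul (hp.mono hΔD)).sub ((hw.mono hΔD).mul (hKc'.mul ?_))
    refine ContinuousOn.div (by fun_prop) (by fun_prop) fun y hy => ?_
    have := (hΔ1 y hy).1
    positivity
  have hmem : ∀ x τ, 0 < τ → |x - r| < t - τ → (x, τ) ∈ Δ := fun x τ h1 h2 => ⟨h1.le, h2.le⟩
  have hZd : ∀ y ∈ Δ, DifferentiableAt ℝ Z y := fun y hy => by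
    have := (hΔ1 y hy).1
    simp only [hZ, coneArg]
    simp only [div_eq_mul_inv]
    exact DifferentiableAt.mul (by fun_prop) (DifferentiableAt.inv (by fun_prop) (by positivity))
  have hKd : ∀ y ∈ Δ, DifferentiableAt ℝ (fun y => K (Z y)) y := fun y hy =>
    (hK _ (hZpos y hy)).differentiableAt.comp y (hZd y hy)
  have hKd' : ∀ y ∈ Δ, DifferentiableAt ℝ (fun y => K' (Z y)) y := fun y hy =>
    (hK' _ (hZpos y hy)).differentiableAt.comp y (hZd y hy)
  have hFd : ∀ x τ, 0 < τ → |x - r| < t - τ → DifferentiableAt ℝ F (x, τ) := by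
    intro x τ h1 h2
    have hm := hmem x τ h1 h2
    have hx : 0 < x := (hΔ1 _ hm).1
    refine ((hKd _ hm).mul (hqd x τ hx h1)).sub ((hwd x τ hx h1).1.mul ((hKd' _ hm).mul ?_))
    simp only [div_eq_mul_inv]
    exact DifferentiableAt.mul (by fun_prop) (DifferentiableAt.inv (by fun_prop) (by positivity))
  have hQd : ∀ x τ, 0 < τ → |x - r| < t - τ → DifferentiableAt ℝ Q (x, τ) := by
    intro x τ h1 h2
    have hm := hmem x τ h1 h2
    have hx : 0 < x := (hΔ1 _ hm).1
    refine ((hKd _ hm).mul (hpd x τ hx h1)).sub ((hwd x τ hx h1).1.mul ((hKd' _ hm).mul ?_))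
    simp only [div_eq_mul_inv]
    exact DifferentiableAt.mul (by fun_prop) (DifferentiableAt.inv (by fun_prop) (by positivity))
  have hFQ : ∀ x τ, 0 < τ → |x - r| < t - τ →
      fderiv ℝ F (x, τ) (0, 1) = fderiv ℝ Q (x, τ) (1, 0) := by
    intro x τ h1 h2
    have hm := hmem x τ h1 h2
    have hx : 0 < x := (hΔ1 _ hm).1
    obtain ⟨hwD, hwp, hwq⟩ := hwd x τ hx h1
    have hz := hZpos _ hm
    have zt := hasDerivAt_coneArg_time hr hx t τ
    have zx := hasDerivAt_coneArg_space hr hx (t - τ)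
    have wt := hasDerivAt_slice_time hwD
    have wx := hasDerivAt_slice_space hwD
    rw [hwq] at wt
    rw [hwp] at wx
    have qt := hasDerivAt_slice_time (hqd x τ hx h1)
    have px := hasDerivAt_slice_space (hpd x τ hx h1)
    have at1 : HasDerivAt (fun s => (t - s) / (r * x)) (-1 / (r * x)) τ :=
      ((hasDerivAt_id τ).const_sub t).div_const _
    have ax1 : HasDerivAt (fun s => (s ^ 2 - r ^ 2 + (t - τ) ^ 2) / (2 * r * s ^ 2))
        ((r ^ 2 - (t - τ) ^ 2) / (r * x ^ 3)) x := by
      refine (((((hasDerivAt_id x).pow 2).sub_const (r ^ 2)).add_const ((t - τ) ^ 2)).div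
        (((hasDerivAt_id x).pow 2).const_mul (2 * r)) (by simp; constructor <;> positivity)
        ).congr_deriv ?_
      simp
      field_simp
      ring
    have hFt := ((((hK _ hz).comp τ zt).mul qt).sub
      (wt.mul (((hK' _ hz).comp τ zt).mul at1)))
    have hQx := ((((hK _ hz).comp x zx).mul px).sub
      (wx.mul (((hK' _ hz).comp x zx).mul ax1)))
    rw [fderiv_apply_time (hFd x τ h1 h2) hFt, fderiv_apply_space (hQd x τ h1 h2) hQx]
    have hwave := hpde x τ hx h1
    have hleg := hode _ hz
    simp only [hZ, Function.comp, Pi.mul_apply] at hleg ⊢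
    have hsecond : ((t - τ) / (r * x)) ^ 2 -
        ((x ^ 2 - r ^ 2 + (t - τ) ^ 2) / (2 * r * x ^ 2)) ^ 2 =
        (1 - coneArg r (t - τ) x ^ 2) / x ^ 2 := by
      rw [coneArg]; field_simp; ring
    have hfirst : -1 / (r * x) - (r ^ 2 - (t - τ) ^ 2) / (r * x ^ 3) =
        -2 * coneArg r (t - τ) x / x ^ 2 := by
      rw [coneArg]; field_simp; ring
    linear_combination K (coneArg r (t - τ) x) * hwave -
      w (x, τ) / x ^ 2 * hleg - w (x, τ) * K'' (coneArg r (t - τ) x) * hsecond -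
      w (x, τ) * K' (coneArg r (t - τ) x) * hfirst
  have hgreen := integral_base_characteristic_triangle ht hFc hQc hFd hQd hFQ
  have hright : ∫ τ in (0 : ℝ)..t, (F (r + (t - τ), τ) - Q (r + (t - τ), τ)) =
      w (r, t) - w (r + t, 0) := by
    have hD : ∀ τ ∈ Icc 0 t, (r + (t - τ), τ) ∈ Ioi (0 : ℝ) ×ˢ Ici (0 : ℝ) := fun τ hτ =>
      ⟨by simp only [mem_Ioi]; linarith [hτ.2], hτ.1⟩
    have hcurve : ContinuousOn (fun τ => (r + (t - τ), τ)) (Icc 0 t) := by fun_prop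
    have hval : ∀ τ ∈ Icc 0 t, F (r + (t - τ), τ) - Q (r + (t - τ), τ) =
        q (r + (t - τ), τ) - p (r + (t - τ), τ) := by
      intro τ hτ
      have hx : 0 < r + (t - τ) := (hD τ hτ).1
      have hz1 : coneArg r (t - τ) (r + (t - τ)) = 1 := by
        rw [coneArg]; field_simp; ring
      simp only [hF, hQ, hZ, hz1, hK1]
      field_simp
      ring
    rw [intervalIntegral.integral_congr (g := fun τ => q (r + (t - τ), τ) - p (r + (t - τ), τ))
      (fun τ hτ => hval τ (by rwa [uIcc_of_le ht.le] at hτ))]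
    rw [intervalIntegral.integral_eq_sub_of_hasDerivAt_of_le (f := fun τ => w (r + (t - τ), τ))
      ht.le (hw.comp hcurve hD)]
    · simp
    · intro τ hτ
      obtain ⟨hwD, hwp, hwq⟩ := hwd (r + (t - τ)) τ (by linarith [hτ.2]) hτ.1
      refine (hwD.hasFDerivAt.comp_hasDerivAt (f := fun τ => (r + (t - τ), τ)) τ
        ((((hasDerivAt_id τ).const_sub t).const_add r).prodMk (hasDerivAt_id τ))).congr_deriv ?_
      rw [show ((-1 : ℝ), (1 : ℝ)) = (0, 1) - (1, 0) by simp, map_sub, hwp, hwq]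
    · refine ContinuousOn.intervalIntegrable ?_
      rw [uIcc_of_le ht.le]
      exact (hq.comp hcurve hD).sub (hp.comp hcurve hD)
  have hleft : ∫ τ in (0 : ℝ)..t, (F (r - (t - τ), τ) + Q (r - (t - τ), τ)) =
      w (r, t) - w (r - t, 0) := by
    have hD : ∀ τ ∈ Icc 0 t, (r - (t - τ), τ) ∈ Ioi (0 : ℝ) ×ˢ Ici (0 : ℝ) := fun τ hτ =>
      ⟨by simp only [mem_Ioi]; linarith [hτ.1], hτ.1⟩
    have hcurve : ContinuousOn (fun τ => (r - (t - τ), τ)) (Icc 0 t) := by fun_prop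
    have hval : ∀ τ ∈ Icc 0 t, F (r - (t - τ), τ) + Q (r - (t - τ), τ) =
        q (r - (t - τ), τ) + p (r - (t - τ), τ) := by
      intro τ hτ
      have hx : 0 < r - (t - τ) := (hD τ hτ).1
      have hz1 : coneArg r (t - τ) (r - (t - τ)) = 1 := by
        rw [coneArg]; field_simp; ring
      simp only [hF, hQ, hZ, hz1, hK1]
      field_simp
      ring
    rw [intervalIntegral.integral_congr (g := fun τ => q (r - (t - τ), τ) + p (r - (t - τ), τ))
      (fun τ hτ => hval τ (by rwa [uIcc_of_le ht.le] at hτ))]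
    rw [intervalIntegral.integral_eq_sub_of_hasDerivAt_of_le (f := fun τ => w (r - (t - τ), τ))
      ht.le (hw.comp hcurve hD)]
    · simp
    · intro τ hτ
      obtain ⟨hwD, hwp, hwq⟩ := hwd (r - (t - τ)) τ (by linarith [hτ.1]) hτ.1
      refine (hwD.hasFDerivAt.comp_hasDerivAt (f := fun τ => (r - (t - τ), τ)) τ
        ((((hasDerivAt_id τ).const_sub t).const_sub r).prodMk (hasDerivAt_id τ))).congr_deriv ?_
      rw [show (-(-1 : ℝ), (1 : ℝ)) = (0, 1) + (1, 0) by simp, map_add, hwp, hwq]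
    · refine ContinuousOn.intervalIntegrable ?_
      rw [uIcc_of_le ht.le]
      exact (hq.comp hcurve hD).add (hp.comp hcurve hD)
  rw [hright, hleft] at hgreen
  simp only [hF, hZ, sub_zero] at hgreen
  linarith

/-- Riemann's representation formula for classical solutions of
`u_tt - u_rr - (2α / r) u_r = 0`, obtained from the substitution `w = r ^ α u`. -/
theorem radial_wave_representation_s8 {K K' K'' : ℝ → ℝ} {α : ℝ}
    (hK : ∀ z, -1 < z → HasDerivAt K (K' z) z) (hK' : ∀ z, -1 < z → HasDerivAt K' (K'' z) z)
    (hK1 : K 1 = 1)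
    (hode : ∀ z, -1 < z → (1 - z ^ 2) * K'' z - 2 * z * K' z + α * (α - 1) * K z = 0)
    {u : ℝ × ℝ → ℝ} (hu : ContDiffOn ℝ 2 u (Ioi 0 ×ˢ Ici 0))
    (hpde : ∀ x τ, 0 < x → 0 < τ →
      deriv (deriv fun s => u (x, s)) τ - deriv (deriv fun s => u (s, τ)) x -
        2 * α / x * deriv (fun s => u (s, τ)) x = 0)
    {r t : ℝ} (ht : 0 < t) (htr : t < r)
    (hu0 : ∀ x ∈ Icc (r - t) (r + t), DifferentiableAt ℝ (fun s => u (x, s)) 0) :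
    2 * (r ^ α * u (r, t)) = (r + t) ^ α * u (r + t, 0) + (r - t) ^ α * u (r - t, 0) +
      ∫ x in (r - t)..(r + t), (K (coneArg r t x) * (x ^ α * deriv (fun s => u (x, s)) 0) -
        x ^ α * u (x, 0) * (K' (coneArg r t x) * (t / (r * x)))) := by
  set D : Set (ℝ × ℝ) := Ioi 0 ×ˢ Ici 0 with hD
  have hDu : UniqueDiffOn ℝ D := (uniqueDiffOn_Ioi 0).prod (uniqueDiffOn_Ici 0)
  have hL : ContDiffOn ℝ 1 (fderivWithin ℝ u D) D := hu.fderivWithin hDu (by norm_num)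
  set ux : ℝ × ℝ → ℝ := fun y => fderivWithin ℝ u D y (1, 0) with hux
  set ut : ℝ × ℝ → ℝ := fun y => fderivWithin ℝ u D y (0, 1) with hut
  have hux1 : ContDiffOn ℝ 1 ux D := hL.clm_apply contDiffOn_const
  have hut1 : ContDiffOn ℝ 1 ut D := hL.clm_apply contDiffOn_const
  have hnhds : ∀ {x τ : ℝ}, 0 < x → 0 < τ → D ∈ nhds (x, τ) := fun hx hτ =>
    prod_mem_nhds (Ioi_mem_nhds hx) (Ici_mem_nhds hτ)
  have hud : ∀ {x τ : ℝ}, 0 < x → 0 < τ → DifferentiableAt ℝ u (x, τ) := fun hx hτ =>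
    (hu.contDiffAt (hnhds hx hτ)).differentiableAt (by norm_num)
  have huxd : ∀ {x τ : ℝ}, 0 < x → 0 < τ → DifferentiableAt ℝ ux (x, τ) := fun hx hτ =>
    (hux1.contDiffAt (hnhds hx hτ)).differentiableAt (by norm_num)
  have hutd : ∀ {x τ : ℝ}, 0 < x → 0 < τ → DifferentiableAt ℝ ut (x, τ) := fun hx hτ =>
    (hut1.contDiffAt (hnhds hx hτ)).differentiableAt (by norm_num)
  have hux_slice : ∀ {x τ : ℝ}, 0 < x → 0 < τ →
      HasDerivAt (fun s => u (s, τ)) (ux (x, τ)) x := fun hx hτ => by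
    have h := hasDerivAt_slice_space (hud hx hτ)
    rwa [← fderivWithin_of_mem_nhds (hnhds hx hτ)] at h
  have hut_slice : ∀ {x τ : ℝ}, 0 < x → 0 < τ →
      HasDerivAt (fun s => u (x, s)) (ut (x, τ)) τ := fun hx hτ => by
    have h := hasDerivAt_slice_time (hud hx hτ)
    rwa [← fderivWithin_of_mem_nhds (hnhds hx hτ)] at h
  have hut_zero : ∀ x ∈ Icc (r - t) (r + t), ut (x, 0) = deriv (fun s => u (x, s)) 0 := by
    intro x hx
    have hx0 : 0 < x := by linarith [hx.1]
    have hmem : (x, (0 : ℝ)) ∈ D := ⟨hx0, le_refl (0 : ℝ)⟩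
    have h1 : HasDerivWithinAt (fun s => u (x, s)) (ut (x, 0)) (Ici 0) 0 :=
      ((hu.differentiableOn (by norm_num)) _ hmem).hasFDerivWithinAt.comp_hasDerivWithinAt
        (f := fun s => (x, s)) 0
        ((hasDerivWithinAt_const _ _ x).prodMk (hasDerivWithinAt_id _ _)) fun s hs => ⟨hx0, hs⟩
    exact (uniqueDiffOn_Ici (0 : ℝ) 0 (le_refl (0 : ℝ))).eq_deriv _ h1
      (hu0 x hx).hasDerivAt.hasDerivWithinAt
  have hpow : ∀ {x : ℝ} (b : ℝ), 0 < x → HasDerivAt (fun s => s ^ b) (b * x ^ (b - 1)) x :=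
    fun b hx => Real.hasDerivAt_rpow_const (Or.inl hx.ne')
  have hpowd : ∀ {x : ℝ} (b τ : ℝ), 0 < x →
      DifferentiableAt ℝ (fun y : ℝ × ℝ => y.1 ^ b) (x, τ) := fun b τ hx =>
    DifferentiableAt.comp (f := Prod.fst) (g := fun s : ℝ => s ^ b) _
      (hpow b hx).differentiableAt differentiableAt_fst
  have hpowc : ∀ b : ℝ, ContinuousOn (fun y : ℝ × ℝ => y.1 ^ b) D := fun b y hy =>
    ((hpow b hy.1).continuousAt.comp (f := Prod.fst) continuous_fst.continuousAt
      ).continuousWithinAt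
  have key := riemann_representation (w := fun y => y.1 ^ α * u y)
    (p := fun y => α * y.1 ^ (α - 1) * u y + y.1 ^ α * ux y) (q := fun y => y.1 ^ α * ut y)
    hK hK' hK1 hode ((hpowc α).mul hu.continuousOn)
    (((continuousOn_const.mul (hpowc _)).mul hu.continuousOn).add
      ((hpowc α).mul hux1.continuousOn))
    ((hpowc α).mul hut1.continuousOn) ?_ ?_ ?_ ?_ ht htr
  · rw [key]
    congr 1
    refine intervalIntegral.integral_congr fun x hx => ?_
    rw [uIcc_of_le (by linarith)] at hx
    simp only [hut_zero x hx]
  · intro x τ hx hτ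
    have hd : DifferentiableAt ℝ (fun y : ℝ × ℝ => y.1 ^ α * u y) (x, τ) :=
      (hpowd α τ hx).mul (hud hx hτ)
    exact ⟨hd, fderiv_apply_space hd ((hpow α hx).mul (hux_slice hx hτ)),
      fderiv_apply_time hd ((hut_slice hx hτ).const_mul (x ^ α))⟩
  · intro x τ hx hτ
    exact (((hpowd _ τ hx).const_mul α).mul (hud hx hτ)).add ((hpowd α τ hx).mul (huxd hx hτ))
  · intro x τ hx hτ
    exact (hpowd α τ hx).mul (hutd hx hτ)
  · intro x τ hx hτ
    have htt : deriv (deriv fun s => u (x, s)) τ = fderiv ℝ ut (x, τ) (0, 1) := by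
      have h : (deriv fun s => u (x, s)) =ᶠ[nhds τ] fun s => ut (x, s) := by
        filter_upwards [Ioi_mem_nhds hτ] with s hs using (hut_slice hx hs).deriv
      rw [h.deriv_eq, (hasDerivAt_slice_time (hutd hx hτ)).deriv]
    have hxx : deriv (deriv fun s => u (s, τ)) x = fderiv ℝ ux (x, τ) (1, 0) := by
      have h : (deriv fun s => u (s, τ)) =ᶠ[nhds x] fun s => ux (s, τ) := by
        filter_upwards [Ioi_mem_nhds hx] with s hs using (hux_slice hs hτ).deriv
      rw [h.deriv_eq, (hasDerivAt_slice_space (huxd hx hτ)).deriv]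
    have hwave := hpde x τ hx hτ
    rw [htt, hxx, (hux_slice hx hτ).deriv] at hwave
    rw [fderiv_apply_time (F := fun y => y.1 ^ α * ut y) ((hpowd α τ hx).mul (hutd hx hτ))
        ((hasDerivAt_slice_time (hutd hx hτ)).const_mul (x ^ α)),
      fderiv_apply_space (F := fun y => α * y.1 ^ (α - 1) * u y + y.1 ^ α * ux y)
        ((((hpowd _ τ hx).const_mul α).mul (hud hx hτ)).add ((hpowd α τ hx).mul (huxd hx hτ)))
        ((((hpow (α - 1) hx).const_mul α).mul (hux_slice hx hτ)).add
          ((hpow α hx).mul (hasDerivAt_slice_space (huxd hx hτ))))]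
    have e1 : x ^ (α - 1) = x ^ α / x := Real.rpow_sub_one hx.ne' α
    have e2 : x ^ (α - 1 - 1) = x ^ α / x / x := by rw [Real.rpow_sub_one hx.ne', e1]
    simp only [e1, e2]
    field_simp at hwave ⊢
    linear_combination x ^ α * x * hwave

theorem coneArg_le_one {r t lam : ℝ} (hr : 0 < r) (hlam : 0 < lam) (h : |lam - r| ≤ t) :
    coneArg r t lam ≤ 1 := by
  rw [coneArg, div_le_one (by positivity)]
  nlinarith [abs_le.1 h, sq_le_sq' (abs_le.1 h).1 (abs_le.1 h).2]

theorem inv_one_add_le_coneArg {r t lam ζ : ℝ} (hr : 0 < r) (ht : 0 ≤ t) (hlam : 0 < lam)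
    (hζ0 : 0 < ζ) (hζ1 : ζ ≤ 1) (h : (2 + ζ) * t ≤ ζ * r) :
    1 / (1 + ζ) ≤ coneArg r t lam := by
  rw [coneArg, div_le_div_iff₀ (by positivity) (by positivity)]
  have h1 : ((2 + ζ) * t) ^ 2 ≤ (ζ * r) ^ 2 := by gcongr
  have h2 : ζ ^ 2 * r ^ 2 ≤ ζ * r ^ 2 := by
    gcongr
    nlinarith
  nlinarith [sq_nonneg (lam - r), sq_nonneg t, mul_nonneg hζ0.le (sq_nonneg t),
    mul_nonneg hζ0.le (sq_nonneg lam), mul_nonneg (sq_nonneg ζ) (sq_nonneg t)]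

/-- The Legendre function of degree `k - 1/2`, given by the Mehler integral; it is normalized to
take the value `1` at `1`. -/
noncomputable def legendreKernel (k : ℤ) (z : ℝ) : ℝ :=
  2 * √2 / Real.pi * angularAvg (mehler k) 0 z

/-- The derivative of `legendreKernel`. -/
noncomputable def legendreKernel' (k : ℤ) (z : ℝ) : ℝ :=
  2 * √2 / Real.pi * angularAvg (mehler' k) 1 z

theorem hasDerivAt_legendreKernel (k : ℤ) {z : ℝ} (hz : -1 < z) :
    HasDerivAt (legendreKernel k) (legendreKernel' k z) z :=
  (hasDerivAt_angularAvg (fun _ => hasDerivAt_mehler k)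
    (fun _ hw => (hasDerivAt_mehler' k hw).continuousAt.continuousWithinAt) 0 hz).const_mul _

theorem hasDerivAt_legendreKernel' (k : ℤ) {z : ℝ} (hz : -1 < z) :
    HasDerivAt (legendreKernel' k) (2 * √2 / Real.pi * angularAvg (mehler'' k) 2 z) z :=
  (hasDerivAt_angularAvg (fun _ => hasDerivAt_mehler' k) (continuousOn_mehler'' k) 1 hz).const_mul _

theorem legendreKernel_one (k : ℤ) : legendreKernel k 1 = 1 := by
  rw [legendreKernel, angularAvg_mehler_one]
  field_simp

theorem legendreKernel_ode (k : ℤ) {z : ℝ} (hz : -1 < z) :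
    (1 - z ^ 2) * (2 * √2 / Real.pi * angularAvg (mehler'' k) 2 z) -
      2 * z * legendreKernel' k z + ((k : ℝ) ^ 2 - 1 / 4) * legendreKernel k z = 0 := by
  have h := angularAvg_legendre (fun _ => hasDerivAt_mehler k) (fun _ => hasDerivAt_mehler' k)
    (continuousOn_mehler'' k) (fun _ => mehler_ode k) hz
  rw [legendreKernel, legendreKernel']
  linear_combination 2 * √2 / Real.pi * h

/-- the lower bound for the free radial wave solution in even
space dimensions `n = 2m`, `m ≥ 2`, on the set `Σ₁`. -/
theorem stmt_8 (m n : ℕ) (hm : 2 ≤ m) (hn : n = 2 * m)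
    (κ : ℝ) (hκ0 : 0 < κ)
    (ζ : ℝ) (hζ0 : 0 < ζ) (hζ1 : ζ ≤ 1)
    (hT : ∀ z : ℝ, 1 / (1 + ζ) ≤ z → z ≤ 1 →
      1 / 2 ≤ chebT ((m : ℤ) - 1) z ∧ chebT ((m : ℤ) - 1) z ≤ 1 ∧
      0 < chebT' ((m : ℤ) - 1) z ∧ chebT' ((m : ℤ) - 1) z ≤ ((m : ℝ) - 1) ^ 2)
    (C2m : ℝ) (hC2m : C2m = (m : ℝ) - 3 / 8 + 5 * ζ * ((m : ℝ) - 1) ^ 2 / 3)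
    (δ : ℝ) (hδ : 2 / ζ ≤ δ)
    (f g : ℝ → ℝ)
    (hf : ContDiffOn ℝ 2 f (Ioi (0 : ℝ))) (hg : ContDiffOn ℝ 1 g (Ioi (0 : ℝ)))
    (R C₃ : ℝ) (hR : 0 < R) (hC₃ : 0 < C₃)
    (hdata : ∀ r : ℝ, R ≤ r →
      0 < f r ∧ 0 < g r ∧
      C₃ / (1 + r) ^ (1 + κ) ≤ -C2m * f r / r - |deriv f r| + g r / 2)
    (u₀ : ℝ → ℝ → ℝ)
    (hu₀ : ContDiffOn ℝ 2 (fun q : ℝ × ℝ => u₀ q.1 q.2) (Ioi (0 : ℝ) ×ˢ Ici (0 : ℝ)))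
    (hpde : ∀ r : ℝ, 0 < r → ∀ t : ℝ, 0 ≤ t →
      deriv (deriv (u₀ r)) t - deriv (fun s => deriv (fun s' => u₀ s' t) s) r -
        ((n : ℝ) - 1) / r * deriv (fun s => u₀ s t) r = 0)
    (hic1 : ∀ r : ℝ, 0 < r → u₀ r 0 = f r)
    (hic2 : ∀ r : ℝ, 0 < r → deriv (u₀ r) 0 = g r) :
    ∀ r t : ℝ, 0 < r → 0 < t → 0 < max R (δ * t) → max R (δ * t) ≤ r - t →
      (1 / (Real.pi * r ^ (m - 1))) *
        ∫ ρ in (0 : ℝ)..t, (ρ / Real.sqrt (t ^ 2 - ρ ^ 2)) *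
          ∫ lam in (r - ρ)..(r + ρ),
            (-2 * C2m * f lam / lam - 2 * |deriv f lam| + g lam) * lam ^ m /
              (Real.sqrt (lam ^ 2 - (r - ρ) ^ 2) * Real.sqrt ((r + ρ) ^ 2 - lam ^ 2))
      ≤ u₀ r t := by
  intro r t hr ht _ hmax
  have hRr : R ≤ r - t := (le_max_left _ _).trans hmax
  have htr : t < r := by linarith
  have hcone : (2 + ζ) * t ≤ ζ * r := by
    have h1 : 2 / ζ * t ≤ r - t := by
      refine le_trans ?_ ((le_max_right _ _).trans hmax)
      gcongr
    rw [div_mul_eq_mul_div, div_le_iff₀ hζ0] at h1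
    linarith
  have hle : r - t ≤ r + t := by linarith
  set I := Icc (r - t) (r + t) with hI
  have hIpos : ∀ x ∈ I, 0 < x := fun x hx => by linarith [hx.1]
  have hIR : ∀ x ∈ I, R ≤ x := fun x hx => hRr.trans hx.1
  set N : ℤ := (m : ℤ) - 1 with hN
  have hNcast : (N : ℝ) = (m : ℝ) - 1 := by simp [hN]
  set α : ℝ := (m : ℝ) - 1 / 2 with hα
  have hrep := radial_wave_representation_s8 (α := α) (u := fun q => u₀ q.1 q.2)
    (fun _ => hasDerivAt_legendreKernel N) (fun _ => hasDerivAt_legendreKernel' N)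
    (legendreKernel_one N)
    (fun z hz => by
      have h := legendreKernel_ode N hz
      rw [hNcast] at h
      linear_combination h)
    hu₀
    (fun x τ hx hτ => by
      have h := hpde x hx τ hτ.le
      rwa [show (n : ℝ) - 1 = 2 * α by rw [hn, hα]; push_cast; ring] at h)
    ht htr
    (fun x hx => differentiableAt_of_deriv_ne_zero (by
      rw [hic2 x (hIpos x hx)]
      exact (hdata x (hIR x hx)).2.1.ne'))
  set G : ℝ → ℝ := fun x => -2 * C2m * f x / x - 2 * |deriv f x| + g x with hG
  have hG0 : ∀ x ∈ I, 0 ≤ G x := by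
    intro x hx
    have hx0 := hIpos x hx
    have h := (hdata x (hIR x hx)).2.2
    have h1 : 0 < C₃ / (1 + x) ^ (1 + κ) := by positivity
    have h2 : G x = 2 * (-C2m * f x / x - |deriv f x| + g x / 2) := by simp only [hG]; ring
    linarith
  have hIsub : I ⊆ Ioi 0 := hIpos
  have hfc : ContinuousOn f I := hf.continuousOn.mono hIsub
  have hgc : ContinuousOn g I := hg.continuousOn.mono hIsub
  have hfc' : ContinuousOn (deriv f) I :=
    (hf.continuousOn_deriv_of_isOpen isOpen_Ioi (by norm_num)).mono hIsub
  have hGc : ContinuousOn G I :=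
    (((continuousOn_const.mul hfc).div continuousOn_id fun x hx => (hIpos x hx).ne').sub
      (continuousOn_const.mul hfc'.abs)).add hgc
  have hiter := iterated_integral_le ht htr (Γ := fun x => G x * x ^ m)
    (hGc.mul (by fun_prop)) (fun x hx => mul_nonneg (hG0 x hx) (pow_nonneg (hIpos x hx).le m))
  have hα_pow : ∀ {x : ℝ}, 0 < x → x ^ α = x ^ m / √x := fun {x} hx => by
    rw [hα, Real.rpow_sub hx, Real.rpow_natCast, Real.sqrt_eq_rpow]
  have hz1 : ∀ x ∈ I, coneArg r t x ≤ 1 := fun x hx =>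
    coneArg_le_one hr (hIpos x hx) (abs_le.2 ⟨by linarith [hx.1], by linarith [hx.2]⟩)
  have hz0 : ∀ x ∈ I, 1 / (1 + ζ) ≤ coneArg r t x := fun x hx =>
    inv_one_add_le_coneArg hr ht.le (hIpos x hx) hζ0 hζ1 hcone
  have hza : -1 < 1 / (1 + ζ) := by linarith [show 0 < 1 / (1 + ζ) by positivity]
  have hmaps : MapsTo (coneArg r t) I (Ioi (-1)) := fun x hx => hza.trans_le (hz0 x hx)
  have hconec : ContinuousOn (coneArg r t) I := (continuousOn_coneArg r t hr).mono hIsub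
  have hpoint : ∀ x ∈ I, 2 / Real.pi * √r *
      (G x * x ^ m * (baseKernel (coneArg r t x) / √(2 * x * r))) ≤
      legendreKernel N (coneArg r t x) * (x ^ α * deriv (fun s => u₀ x s) 0) -
        x ^ α * u₀ x 0 * (legendreKernel' N (coneArg r t x) * (t / (r * x))) := by
    intro x hx
    have hx0 := hIpos x hx
    obtain ⟨hfx, hgx, -⟩ := hdata x (hIR x hx)
    rw [hic1 x hx0, show deriv (fun s => u₀ x s) 0 = g x from hic2 x hx0]
    set z := coneArg r t x with hz
    set b := 2 * √2 / Real.pi * baseKernel z with hb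
    have hb0 : 0 ≤ b := mul_nonneg (by positivity) (baseKernel_nonneg z)
    have hk : 1 / 2 * b ≤ legendreKernel N z := by
      have h := half_baseKernel_le hza (hz0 x hx) (hz1 x hx) fun w h1 h2 => (hT w h1 h2).1
      rw [hb, legendreKernel, mul_left_comm]
      gcongr
    have hk' : legendreKernel' N z ≤ ((m : ℝ) - 1) ^ 2 * b := by
      have h := angularAvg_mehler'_le hza (hz0 x hx) (hz1 x hx) (sq_nonneg ((m : ℝ) - 1))
        (fun w h1 h2 => by linarith [(hT w h1 h2).1]) fun w h1 h2 => (hT w h1 h2).2.2.2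
      rw [hb, legendreKernel', mul_left_comm]
      gcongr
    have hC : ((m : ℝ) - 1) ^ 2 * (t / r) ≤ C2m := by
      have h1 : t / r ≤ ζ := by
        rw [div_le_iff₀ hr]; linarith [mul_pos hζ0 ht]
      have h2 : (2 : ℝ) ≤ m := by exact_mod_cast hm
      have h3 := mul_le_mul_of_nonneg_left h1 (sq_nonneg ((m : ℝ) - 1))
      rw [hC2m]
      linarith [mul_nonneg (sq_nonneg ((m : ℝ) - 1)) hζ0.le]
    have hlower : 1 / 2 * G x * b ≤
        legendreKernel N z * g x - f x * (legendreKernel' N z * (t / (r * x))) := by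
      have h1 : 1 / 2 * b * g x ≤ legendreKernel N z * g x := by gcongr
      have h2 : f x * (legendreKernel' N z * (t / (r * x))) ≤
          f x * (((m : ℝ) - 1) ^ 2 * b * (t / (r * x))) := by gcongr
      have h3 : f x * (((m : ℝ) - 1) ^ 2 * b * (t / (r * x))) =
          ((m : ℝ) - 1) ^ 2 * (t / r) * (f x / x * b) := by field_simp
      have h4 : ((m : ℝ) - 1) ^ 2 * (t / r) * (f x / x * b) ≤ C2m * (f x / x * b) := by gcongr
      have h5 : 1 / 2 * G x * b =
          1 / 2 * b * g x - C2m * (f x / x * b) - |deriv f x| * b := by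
        simp only [hG]; ring
      linarith [mul_nonneg (abs_nonneg (deriv f x)) hb0]
    have hleft : 2 / Real.pi * √r * (G x * x ^ m * (baseKernel z / √(2 * x * r))) =
        x ^ α * (1 / 2 * G x * b) := by
      rw [hα_pow hx0, hb, Real.sqrt_mul (by positivity), Real.sqrt_mul (by positivity)]
      have h2 : √2 * √2 = 2 := Real.mul_self_sqrt (by norm_num)
      have hsx : 0 < √x := Real.sqrt_pos.2 hx0
      have hsr : 0 < √r := Real.sqrt_pos.2 hr
      field_simp
      linear_combination -(G x * baseKernel z) * h2
    rw [hleft]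
    calc x ^ α * (1 / 2 * G x * b)
        ≤ x ^ α * (legendreKernel N z * g x -
          f x * (legendreKernel' N z * (t / (r * x)))) := by gcongr
      _ = _ := by ring
  have hint := intervalIntegral.integral_mono_on hle (μ := volume)
    (ContinuousOn.intervalIntegrable (by
      rw [uIcc_of_le hle]
      refine continuousOn_const.mul ((hGc.mul (by fun_prop)).mul
        ((continuousOn_baseKernel.comp hconec hmaps).div (by fun_prop) fun x hx => ?_))
      have := hIpos x hx
      positivity))
    (ContinuousOn.intervalIntegrable (by
      rw [uIcc_of_le hle]
      have hpowc : ContinuousOn (fun x : ℝ => x ^ α) I := fun x hx =>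
        (Real.continuousAt_rpow_const x α (Or.inl (hIpos x hx).ne')).continuousWithinAt
      have hKc : ContinuousOn (fun x => legendreKernel N (coneArg r t x)) I := fun x hx =>
        (hasDerivAt_legendreKernel N (hmaps hx)).continuousAt.comp_continuousWithinAt
          (hconec x hx)
      have hKc' : ContinuousOn (fun x => legendreKernel' N (coneArg r t x)) I := fun x hx =>
        (hasDerivAt_legendreKernel' N (hmaps hx)).continuousAt.comp_continuousWithinAt
          (hconec x hx)
      refine (hKc.mul (hpowc.mul (hgc.congr fun x hx => hic2 x (hIpos x hx)))).sub
        ((hpowc.mul (hfc.congr fun x hx => hic1 x (hIpos x hx))).mul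
          (hKc'.mul (continuousOn_const.div (by fun_prop) fun x hx => ?_)))
      have := hIpos x hx
      positivity))
    hpoint
  rw [intervalIntegral.integral_const_mul] at hint
  have hbdry : ∀ x ∈ I, 0 ≤ x ^ α * u₀ x 0 := fun x hx => by
    rw [hic1 x (hIpos x hx)]
    exact mul_nonneg (Real.rpow_nonneg (hIpos x hx).le _) (hdata x (hIR x hx)).1.le
  have hb1 := hbdry (r + t) ⟨hle, le_rfl⟩
  have hb2 := hbdry (r - t) ⟨le_rfl, hle⟩
  have hmain : 2 / Real.pi * √r * ∫ x in (r - t)..(r + t),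
      G x * x ^ m * (baseKernel (coneArg r t x) / √(2 * x * r)) ≤ 2 * (r ^ α * u₀ r t) := by
    refine hint.trans ?_
    rw [hrep]
    linarith
  have hmul := (mul_le_mul_of_nonneg_left hiter
    (by positivity : 0 ≤ 2 / Real.pi * √r)).trans hmain
  rw [hα_pow hr] at hmul
  have hsr : 0 < √r := Real.sqrt_pos.2 hr
  have hrm : r ^ m = r ^ (m - 1) * (√r * √r) := by
    rw [Real.mul_self_sqrt hr.le, ← pow_succ, Nat.sub_add_cancel (by lia)]
  rw [hrm] at hmul
  rw [one_div_mul_eq_div, div_le_iff₀ (by positivity)]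
  refine le_of_mul_le_mul_left (hmul.trans_eq ?_) (by positivity : 0 < 2 / Real.pi * √r)
  field_simp
end
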